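/- Fix c > 0, p > 0 and 0 < α < 2/(p+2). Then log(sup_G P[T_{oz} < α n²/log n]) / log n → −(α(p+2)−2)²/(8α) as n → ∞, where the supremum runs over all weighted graphs G with a vertex o and a vertex set z satisfying dist(o,z) ≥ n and w_z/w_o < c n^p. -/

import Mathlib

open MeasureTheory Filter
open scoped Classical ENNReal

namespace RWHitting

/-- A weighted graph on a vertex set `V`: a symmetric weight function with
positive finite vertex weights. -/
structure WeightedGraph (V : Type*) where
  w : V → V → ℝ≥0∞
  symm : ∀ x y, w x y = w y x
  vw_pos : ∀ x, 0 < ∑' y, w x y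
  vw_lt_top : ∀ x, ∑' y, w x y < ⊤

namespace WeightedGraph

variable {V : Type*}

/-- The weight of a vertex. -/
noncomputable def vw (G : WeightedGraph V) (x : V) : ℝ≥0∞ := ∑' y, G.w x y

/-- The weight of a vertex set. -/
noncomputable def setWeight (G : WeightedGraph V) (z : Set V) : ℝ≥0∞ := ∑' x : z, G.vw x

/-- `G.distGE o z m` : every path of positive-weight steps from `o` into `z` has length `≥ m`. -/
def distGE (G : WeightedGraph V) (o : V) (z : Set V) (m : ℕ) : Prop :=
  ∀ (k : ℕ) (p : ℕ → V), p 0 = o → (∀ i, i < k → 0 < G.w (p i) (p (i+1))) → p k ∈ z → m ≤ k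

/-- Transition probabilities of the random walk on `G`. -/
noncomputable def trans (G : WeightedGraph V) (x y : V) : ℝ≥0∞ := G.w x y / G.vw x

/-- Graph distance (as an extended nonneg real). -/
noncomputable def edist (G : WeightedGraph V) (x y : V) : ℝ≥0∞ :=
  ⨅ (k : ℕ) (_ : ∃ p : ℕ → V, p 0 = x ∧ p k = y ∧ ∀ i, i < k → 0 < G.w (p i) (p (i+1))),
    (k : ℝ≥0∞)

/-- Total weight of the edges at distance `n` from `o` (each non-loop edge counted in both
orientations). -/
noncomputable def boundaryWeight (G : WeightedGraph V) (o : V) (n : ℕ) : ℝ≥0∞ :=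
  ∑' q : V × V, if min (G.edist o q.1) (G.edist o q.2) = (n : ℝ≥0∞) then G.w q.1 q.2 else 0

end WeightedGraph

variable {V : Type*}

/-- `μ` is the law of the random walk on `G` started at `o`. -/
def IsRandomWalk [MeasurableSpace V] (G : WeightedGraph V) (o : V)
    (μ : Measure (ℕ → V)) : Prop :=
  IsProbabilityMeasure μ ∧
  ∀ (k : ℕ) (x : Fin (k+1) → V),
    μ {ω | ∀ i : Fin (k+1), ω (i : ℕ) = x i}
      = (if x 0 = o then 1 else 0) * ∏ i : Fin k, G.trans (x i.castSucc) (x i.succ)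

/-- First hitting time of the set `z` (`∞` if `z` is never visited). -/
noncomputable def hitTime (z : Set V) (ω : ℕ → V) : ℝ≥0∞ :=
  ⨅ (k : ℕ) (_ : ω k ∈ z), (k : ℝ≥0∞)

/-- Expected hitting time of `z`. -/
noncomputable def expHit [MeasurableSpace V] (μ : Measure (ℕ → V)) (z : Set V) : ℝ≥0∞ :=
  ∫⁻ ω, hitTime z ω ∂μ

/-- Number of visits to `o` (counting time 0) strictly before hitting `z`. -/
noncomputable def visitsBefore (z : Set V) (o : V) (ω : ℕ → V) : ℝ≥0∞ :=
  ∑' k : ℕ, if ω k = o ∧ (k : ℝ≥0∞) < hitTime z ω then 1 else 0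

/-- Effective resistance between `o` and `z`, defined probabilistically via the random walk
law `μ`:  `w_o r_{oz}` is the expected number of visits to `o` before hitting `z`. -/
noncomputable def resistance [MeasurableSpace V] (G : WeightedGraph V) (o : V) (z : Set V)
    (μ : Measure (ℕ → V)) : ℝ≥0∞ :=
  (∫⁻ ω, visitsBefore z o ω ∂μ) / G.vw o

/-- One-step transition probabilities for the biased simple random walk on `ℤ`
with odds `1 : g` of going left/right. -/
noncomputable def biasedStep (g : ℝ) (a b : ℤ) : ℝ≥0∞ :=
  if b = a + 1 then ENNReal.ofReal (g / (g+1))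
  else if b = a - 1 then ENNReal.ofReal (1 / (g+1)) else 0

/-- `ν` is the law of the biased simple random walk on `ℤ` started at `0`,
stepping right with probability `g/(g+1)` and left with probability `1/(g+1)`. -/
def IsBiasedWalk (g : ℝ) (ν : Measure (ℕ → ℤ)) : Prop :=
  IsProbabilityMeasure ν ∧
  ∀ (k : ℕ) (x : Fin (k+1) → ℤ),
    ν {ω | ∀ i : Fin (k+1), ω (i : ℕ) = x i}
      = (if x 0 = 0 then 1 else 0) * ∏ i : Fin k, biasedStep g (x i.castSucc) (x i.succ)

/-- `e^{-λ t}` for an extended-real time `t`, with the convention `e^{-λ ∞} = 0`. -/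
noncomputable def expNeg (lam : ℝ) (t : ℝ≥0∞) : ℝ≥0∞ :=
  if t = ⊤ then 0 else ENNReal.ofReal (Real.exp (-lam * t.toReal))

/-- The set of probabilities `P[T_{oz} < α n²/log n]` over all weighted graphs (with vertex
set indexed by `ℕ`) with `dist(o,z) ≥ n` and `w_z/w_o < c n^p`. -/
def PsetPoly (c p α : ℝ) (n : ℕ) : Set ℝ≥0∞ :=
  {t | ∃ (G : WeightedGraph ℕ) (o : ℕ) (z : Set ℕ) (μ : Measure (ℕ → ℕ)),
    IsRandomWalk G o μ ∧ G.distGE o z n ∧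
    G.setWeight z / G.vw o < ENNReal.ofReal (c * (n : ℝ) ^ p) ∧
    t = μ {ω | hitTime z ω < ENNReal.ofReal (α * n ^ 2 / Real.log n)}}

section Existence

open ProbabilityTheory Preorder

theorem WeightedGraph.vw_ne_zero (G : WeightedGraph V) (x : V) : G.vw x ≠ 0 := (G.vw_pos x).ne'

theorem WeightedGraph.vw_ne_top (G : WeightedGraph V) (x : V) : G.vw x ≠ ⊤ := (G.vw_lt_top x).ne

theorem WeightedGraph.tsum_trans (G : WeightedGraph V) (x : V) : ∑' y, G.trans x y = 1 := by
  simp only [WeightedGraph.trans, div_eq_mul_inv, ENNReal.tsum_mul_right]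
  exact ENNReal.mul_inv_cancel (G.vw_ne_zero x) (G.vw_ne_top x)

/-- The transition kernel of the random walk on a weighted graph. -/
noncomputable def WeightedGraph.kernel [Countable V] [MeasurableSpace V]
    [MeasurableSingletonClass V] (G : WeightedGraph V) : Kernel V V :=
  Kernel.ofFunOfCountable fun x =>
    PMF.toMeasure ⟨G.trans x, G.tsum_trans x ▸ ENNReal.summable.hasSum⟩

theorem WeightedGraph.kernel_singleton [Countable V] [MeasurableSpace V]
    [MeasurableSingletonClass V] (G : WeightedGraph V) (x y : V) :
    G.kernel x {y} = G.trans x y :=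
  PMF.toMeasure_apply_singleton _ _ (measurableSet_singleton y)

instance [Countable V] [MeasurableSpace V] [MeasurableSingletonClass V] (G : WeightedGraph V) :
    IsMarkovKernel G.kernel :=
  ⟨fun _ => PMF.toMeasure.isProbabilityMeasure _⟩

/-- Every weighted graph on a countable vertex set carries a random walk. -/
theorem WeightedGraph.exists_isRandomWalk [Countable V] [MeasurableSpace V]
    [MeasurableSingletonClass V] (G : WeightedGraph V) (o : V) :
    ∃ μ : Measure (ℕ → V), IsRandomWalk G o μ := by
  let κ : (n : ℕ) → Kernel (Π _ : Finset.Iic n, V) V := fun n =>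
    G.kernel.comap (fun x => x ⟨n, by simp⟩) (by fun_prop)
  have hκ : ∀ n, IsMarkovKernel (κ n) := fun n => by dsimp only [κ]; infer_instance
  let μ : Measure (ℕ → V) := Kernel.trajMeasure (X := fun _ => V) (Measure.dirac o) κ
  have hμ : IsProbabilityMeasure μ := by dsimp only [μ]; infer_instance
  refine ⟨μ, hμ, fun k => ?_⟩
  induction k with
  | zero =>
    intro x
    have h0 : μ.map (frestrictLe (π := fun _ => V) 0) = Measure.dirac (fun _ => o) := by
      simp only [μ, Kernel.trajMeasure]
      rw [Measure.map_comp _ _ (by fun_prop), Kernel.traj_map_frestrictLe,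
        Kernel.partialTraj_self, Measure.id_comp, Measure.map_dirac]
      rfl
    have hs : {ω : ℕ → V | ∀ i : Fin (0 + 1), ω (i : ℕ) = x i}
        = frestrictLe (π := fun _ => V) 0 ⁻¹' {y | y ⟨0, by simp⟩ = x 0} := by
      ext ω
      simp [Fin.forall_fin_one]
    rw [hs, ← Measure.map_apply (measurable_frestrictLe _), h0, Measure.dirac_apply']
    · simp [Set.indicator_apply, eq_comm]
    all_goals exact (measurable_pi_apply _) (measurableSet_singleton _)
  | succ k ih =>
    intro x
    have h1 := Kernel.map_frestrictLe_trajMeasure_compProd_eq_map_trajMeasure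
      (X := fun _ => V) (μ₀ := Measure.dirac o) (κ := κ) (a := k)
    let A : Set (Π _ : Finset.Iic k, V) :=
      {y | ∀ i : Fin (k + 1), y ⟨i, by simp; omega⟩ = x i.castSucc}
    have hA : MeasurableSet A := by
      have : A = ⋂ i : Fin (k + 1), {y | y ⟨i, by simp; omega⟩ = x i.castSucc} := by
        ext; simp [A]
      rw [this]
      exact MeasurableSet.iInter fun i => (measurable_pi_apply _) (measurableSet_singleton _)
    have hs : {ω : ℕ → V | ∀ i : Fin (k + 1 + 1), ω (i : ℕ) = x i}
        = (fun ω : ℕ → V => (frestrictLe (π := fun _ => V) k ω, ω (k + 1))) ⁻¹'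
          (A ×ˢ {x (Fin.last (k + 1))}) := by
      ext ω
      simp [A, Fin.forall_fin_succ' (n := k + 1)]
    have hA' : frestrictLe (π := fun _ => V) k ⁻¹' A
        = {ω : ℕ → V | ∀ i : Fin (k + 1), ω (i : ℕ) = x i.castSucc} := by
      ext ω
      simp [A]
    rw [hs, ← Measure.map_apply (by fun_prop) (hA.prod (measurableSet_singleton _))]
    change (μ.map _) _ = _
    rw [← h1, Measure.compProd_apply_prod hA (measurableSet_singleton _)]
    have h2 : ∀ y ∈ A, κ k y {x (Fin.last (k + 1))}
        = G.trans (x (Fin.last k).castSucc) (x (Fin.last k).succ) := by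
      intro y hy
      have : y ⟨k, by simp⟩ = x (Fin.last k).castSucc := hy (Fin.last k)
      simp only [κ, Kernel.comap_apply, this, G.kernel_singleton, Fin.succ_last]
    rw [setLIntegral_congr_fun hA h2, setLIntegral_const, Measure.map_apply (by fun_prop) hA, hA',
      ih, Fin.prod_univ_castSucc]
    simp only [Fin.castSucc_zero, Fin.succ_castSucc]
    rw [mul_comm, mul_assoc]
    rfl

end Existence

section HittingProbabilities

/-- `G.firstHit z k x` is the probability that the random walk started at `x` visits `z` for the
first time at time `k`. -/
noncomputable def WeightedGraph.firstHit (G : WeightedGraph V) (z : Set V) : ℕ → V → ℝ≥0∞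
  | 0, x => if x ∈ z then 1 else 0
  | k + 1, x => if x ∈ z then 0 else ∑' y, G.trans x y * G.firstHit z k y

/-- The paths of length `k` that visit `z` at their end and not before. -/
def firstHitPaths (z : Set V) (k : ℕ) : Set (Fin (k + 1) → V) :=
  {q | q (Fin.last k) ∈ z ∧ ∀ i : Fin k, q i.castSucc ∉ z}

theorem cons_mem_firstHitPaths {z : Set V} {k : ℕ} {a : V} {q : Fin (k + 1) → V} :
    (Fin.cons a q : Fin (k + 1 + 1) → V) ∈ firstHitPaths z (k + 1) ↔
      a ∉ z ∧ q ∈ firstHitPaths z k := by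
  simp only [firstHitPaths, Set.mem_ofPred_eq, Fin.forall_fin_succ (n := k), ← Fin.succ_last,
    Fin.cons_succ, Fin.castSucc_zero, Fin.cons_zero, ← Fin.succ_castSucc]
  tauto

theorem WeightedGraph.tsum_firstHitPaths (G : WeightedGraph V) (z : Set V) (k : ℕ) (x : V) :
    ∑' q : Fin (k + 1) → V, (firstHitPaths z k).indicator
      (fun q => (if q 0 = x then 1 else 0) * ∏ i : Fin k, G.trans (q i.castSucc) (q i.succ)) q
      = G.firstHit z k x := by
  induction k generalizing x with
  | zero =>
    rw [← (Equiv.funUnique (Fin 1) V).symm.tsum_eq, tsum_eq_single x]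
    · simp [Set.indicator_apply, firstHitPaths, WeightedGraph.firstHit]
    · intro y hy
      simp [Set.indicator_apply, hy]
  | succ k ih =>
    rw [← (Fin.consEquiv (fun _ => V)).tsum_eq, ENNReal.tsum_prod', tsum_eq_single x]
    · simp only [WeightedGraph.firstHit, ← ih, ← ENNReal.tsum_mul_left]
      by_cases hx : x ∈ z
      · simp [Fin.consEquiv, cons_mem_firstHitPaths, hx]
      · rw [if_neg hx, ENNReal.tsum_comm]
        refine tsum_congr fun q => ?_
        rw [tsum_eq_single (q 0)]
        · simp [Fin.consEquiv, Set.indicator_apply, cons_mem_firstHitPaths, hx, Fin.prod_univ_succ]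
        · intro y hy
          simp [Set.indicator_apply, hy.symm]
    · intro y hy
      simp [Fin.consEquiv, Set.indicator_apply, hy]

theorem IsRandomWalk.measure_firstHit [Countable V] [MeasurableSpace V]
    [MeasurableSingletonClass V] {G : WeightedGraph V} {o : V} {μ : Measure (ℕ → V)}
    (h : IsRandomWalk G o μ) (z : Set V) (k : ℕ) :
    μ {ω | ω k ∈ z ∧ ∀ i < k, ω i ∉ z} = G.firstHit z k o := by
  let R : (ℕ → V) → (Fin (k + 1) → V) := fun ω i => ω i
  have hR : Measurable R := by fun_prop
  have hA : {ω | ω k ∈ z ∧ ∀ i < k, ω i ∉ z} = R ⁻¹' firstHitPaths z k := by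
    ext ω
    simp [R, firstHitPaths, Fin.forall_iff]
  have hB : MeasurableSet (firstHitPaths z k) := (Set.to_countable _).measurableSet
  rw [hA, ← Measure.map_apply hR hB, ← Measure.tsum_indicator_apply_singleton _ _ hB,
    ← G.tsum_firstHitPaths z k o]
  refine tsum_congr fun q => ?_
  congr 1
  ext q
  rw [Measure.map_apply hR (measurableSet_singleton _), ← h.2 k q]
  congr 1
  ext ω
  simp [R, funext_iff]

theorem hitTime_lt_iff {z : Set V} {ω : ℕ → V} {t : ℝ≥0∞} :
    hitTime z ω < t ↔ ∃ k : ℕ, (k : ℝ≥0∞) < t ∧ ω k ∈ z ∧ ∀ i < k, ω i ∉ z := by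
  simp only [hitTime, iInf_lt_iff, exists_prop]
  constructor
  · intro h
    have hex : ∃ k, ω k ∈ z := h.imp fun _ hk => hk.1
    obtain ⟨k, hk, hkt⟩ := h
    refine ⟨Nat.find hex, lt_of_le_of_lt ?_ hkt, Nat.find_spec hex, fun i => Nat.find_min hex⟩
    exact_mod_cast Nat.find_min' hex hk
  · rintro ⟨k, hkt, hk, -⟩
    exact ⟨k, hk, hkt⟩

theorem IsRandomWalk.measure_hitTime_lt [Countable V] [MeasurableSpace V]
    [MeasurableSingletonClass V] {G : WeightedGraph V} {o : V} {μ : Measure (ℕ → V)}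
    (h : IsRandomWalk G o μ) (z : Set V) (τ : ℝ) :
    μ {ω | hitTime z ω < ENNReal.ofReal τ}
      = ∑' k : ℕ, if (k : ℝ) < τ then G.firstHit z k o else 0 := by
  have hset : {ω | hitTime z ω < ENNReal.ofReal τ}
      = ⋃ k : ℕ, {ω | (k : ℝ) < τ ∧ ω k ∈ z ∧ ∀ i < k, ω i ∉ z} := by
    ext ω
    simp [hitTime_lt_iff, ← ENNReal.ofReal_natCast, ENNReal.ofReal_lt_ofReal_iff_of_nonneg]
  have hmem : ∀ i : ℕ, MeasurableSet {ω : ℕ → V | ω i ∈ z} := fun i =>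
    measurable_pi_apply i (Set.to_countable z).measurableSet
  rw [hset, measure_iUnion]
  · refine tsum_congr fun k => ?_
    split_ifs with hk
    · simp only [hk, true_and, h.measure_firstHit]
    · simp [hk]
  · intro j k hjk
    rw [Function.onFun, Set.disjoint_left]
    rintro ω ⟨-, hj, hj'⟩ ⟨-, hk, hk'⟩
    rcases lt_or_gt_of_ne hjk with hlt | hlt
    · exact hk' j hlt hj
    · exact hj' k hlt hk
  · intro k
    have : {ω : ℕ → V | (k : ℝ) < τ ∧ ω k ∈ z ∧ ∀ i < k, ω i ∉ z}
        = {ω | (k : ℝ) < τ} ∩ ({ω | ω k ∈ z} ∩ ⋂ i ∈ Set.Iio k, {ω | ω i ∈ z}ᶜ) := by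
      ext ω
      simp
    rw [this]
    exact (MeasurableSet.const _).inter ((hmem k).inter
      (MeasurableSet.biInter (Set.to_countable _) fun i _ => (hmem i).compl))

variable (G : WeightedGraph V) (z : Set V)

theorem WeightedGraph.sum_firstHit_le_one (k : ℕ) (x : V) :
    ∑ j ∈ Finset.range k, G.firstHit z j x ≤ 1 := by
  induction k generalizing x with
  | zero => simp
  | succ k ih =>
    rw [Finset.sum_range_succ']
    by_cases hx : x ∈ z
    · simp [WeightedGraph.firstHit, hx]
    · simp only [WeightedGraph.firstHit, hx, if_false, add_zero]
      rw [← Summable.tsum_finsetSum fun _ _ => ENNReal.summable, ← G.tsum_trans x]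
      simp only [← Finset.mul_sum]
      exact ENNReal.tsum_le_tsum fun y => mul_le_of_le_one_right' (ih y)

theorem WeightedGraph.tsum_vw_mul_firstHit_le (k : ℕ) :
    ∑' x, G.vw x * G.firstHit z k x ≤ G.setWeight z := by
  induction k with
  | zero =>
    rw [WeightedGraph.setWeight, tsum_subtype z G.vw]
    refine ENNReal.tsum_le_tsum fun x => ?_
    simp [WeightedGraph.firstHit, Set.indicator_apply]
  | succ k ih =>
    calc ∑' x, G.vw x * G.firstHit z (k + 1) x
        ≤ ∑' x, ∑' y, G.w x y * G.firstHit z k y := by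
          refine ENNReal.tsum_le_tsum fun x => ?_
          by_cases hx : x ∈ z
          · simp [WeightedGraph.firstHit, hx]
          · simp only [WeightedGraph.firstHit, hx, if_false, ← ENNReal.tsum_mul_left,
              WeightedGraph.trans, ← mul_assoc]
            refine ENNReal.tsum_le_tsum fun y => ?_
            rw [ENNReal.mul_div_cancel (G.vw_ne_zero x) (G.vw_ne_top x)]
      _ = ∑' y, G.vw y * G.firstHit z k y := by
          rw [ENNReal.tsum_comm]
          refine tsum_congr fun y => ?_
          simp only [G.symm _ y, ENNReal.tsum_mul_right, WeightedGraph.vw]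
      _ ≤ _ := ih

/-- The generating function `∑ₖ θᵏ P[T = k]` of the hitting time `T` of `z` from `x`. -/
noncomputable def WeightedGraph.laplace (θ : ℝ≥0∞) (x : V) : ℝ≥0∞ :=
  ∑' k : ℕ, θ ^ k * G.firstHit z k x

variable {θ : ℝ≥0∞}

theorem WeightedGraph.laplace_le_one (hθ : θ ≤ 1) (x : V) : G.laplace z θ x ≤ 1 := by
  refine ENNReal.tsum_le_of_sum_range_le fun k => ?_
  refine le_trans (Finset.sum_le_sum fun j _ => ?_) (G.sum_firstHit_le_one z k x)
  exact mul_le_of_le_one_left' (pow_le_one' hθ j)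

theorem WeightedGraph.laplace_of_notMem {x : V} (hx : x ∉ z) :
    G.vw x * G.laplace z θ x = θ * ∑' y, G.w x y * G.laplace z θ y := by
  have h : ∀ k, G.vw x * (θ ^ (k + 1) * G.firstHit z (k + 1) x)
      = θ * ∑' y, G.w x y * (θ ^ k * G.firstHit z k y) := by
    intro k
    simp only [WeightedGraph.firstHit, hx, if_false, ← ENNReal.tsum_mul_left, WeightedGraph.trans]
    refine tsum_congr fun y => ?_
    calc G.vw x * (θ ^ (k + 1) * (G.w x y / G.vw x * G.firstHit z k y))
        = (G.vw x * (G.w x y / G.vw x)) * (θ ^ (k + 1) * G.firstHit z k y) := by ring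
      _ = θ * (G.w x y * (θ ^ k * G.firstHit z k y)) := by
        rw [ENNReal.mul_div_cancel (G.vw_ne_zero x) (G.vw_ne_top x)]
        ring
  rw [WeightedGraph.laplace, tsum_eq_zero_add' ENNReal.summable, mul_add, ← ENNReal.tsum_mul_left]
  simp only [h, WeightedGraph.laplace, ← ENNReal.tsum_mul_left (a := G.w x _)]
  rw [ENNReal.tsum_mul_left, ENNReal.tsum_comm]
  simp [WeightedGraph.firstHit, hx]

theorem WeightedGraph.tsum_vw_mul_laplace_lt_top (hθ : θ < 1) (hz : G.setWeight z < ⊤) :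
    ∑' x, G.vw x * G.laplace z θ x < ⊤ := by
  calc ∑' x, G.vw x * G.laplace z θ x
      = ∑' k : ℕ, θ ^ k * ∑' x, G.vw x * G.firstHit z k x := by
        simp only [WeightedGraph.laplace, ← ENNReal.tsum_mul_left]
        rw [ENNReal.tsum_comm]
        exact tsum_congr fun k => tsum_congr fun x => mul_left_comm _ _ _
    _ ≤ ∑' k : ℕ, θ ^ k * G.setWeight z :=
        ENNReal.tsum_le_tsum fun k => by gcongr; exact G.tsum_vw_mul_firstHit_le z k
    _ = (1 - θ)⁻¹ * G.setWeight z := by rw [ENNReal.tsum_mul_right, ENNReal.tsum_geometric]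
    _ < ⊤ := ENNReal.mul_lt_top (by simpa using hθ) hz

/-- A bounded subsolution of the equation satisfied by the generating function of the hitting time
is a lower bound for it. -/
theorem WeightedGraph.le_laplace_of_subsolution (hθ : θ < 1) {g : V → ℝ≥0∞} (hg : ∀ x, g x ≤ 1)
    (hsub : ∀ x ∉ z, G.vw x * g x ≤ θ * ∑' y, G.w x y * g y) (x : V) : g x ≤ G.laplace z θ x := by
  have key : ∀ k x, g x ≤ ∑ j ∈ Finset.range k, θ ^ j * G.firstHit z j x + θ ^ k := by
    intro k
    induction k with
    | zero => simpa using hg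
    | succ k ih =>
      intro x
      rw [Finset.sum_range_succ']
      by_cases hx : x ∈ z
      · simpa [WeightedGraph.firstHit, hx] using (hg x).trans le_self_add
      · have h1 : g x ≤ θ * ∑' y, G.trans x y * g y := by
          have h2 := hsub x hx
          rw [mul_comm, ← ENNReal.le_div_iff_mul_le (Or.inl (G.vw_ne_zero x))
            (Or.inl (G.vw_ne_top x))] at h2
          refine h2.trans_eq ?_
          simp only [WeightedGraph.trans, div_eq_mul_inv, mul_assoc, ← ENNReal.tsum_mul_right]
          congr 1
          exact tsum_congr fun y => by ring
        calc g x ≤ θ * ∑' y, G.trans x y * g y := h1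
          _ ≤ θ * ∑' y, G.trans x y *
              (∑ j ∈ Finset.range k, θ ^ j * G.firstHit z j y + θ ^ k) := by
            gcongr with y; exact ih y
          _ = _ := by
            simp only [mul_add, ENNReal.tsum_add, ENNReal.tsum_mul_right, G.tsum_trans x,
              WeightedGraph.firstHit, hx, if_false, Finset.mul_sum, mul_zero, add_zero, one_mul]
            rw [Summable.tsum_finsetSum fun _ _ => ENNReal.summable, Finset.mul_sum, ← pow_succ']
            congr 1
            refine Finset.sum_congr rfl fun j _ => ?_
            rw [← ENNReal.tsum_mul_left, ← ENNReal.tsum_mul_left]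
            exact tsum_congr fun y => by ring
  have hlim : Tendsto (fun k => G.laplace z θ x + θ ^ k) atTop (nhds (G.laplace z θ x + 0)) :=
    tendsto_const_nhds.add (ENNReal.tendsto_pow_atTop_nhds_zero_of_lt_one hθ)
  rw [add_zero] at hlim
  refine ge_of_tendsto' hlim fun k => (key k x).trans ?_
  gcongr
  exact ENNReal.sum_le_tsum _

end HittingProbabilities

section Energy

/-- The graph distance from `x` to `z`, truncated at `n`. -/
noncomputable def WeightedGraph.layer (G : WeightedGraph V) (z : Set V) (n : ℕ) (x : V) : ℕ :=
  sInf {k | n ≤ k ∨ ∃ p : ℕ → V, p 0 = x ∧ (∀ i < k, 0 < G.w (p i) (p (i + 1))) ∧ p k ∈ z}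

variable (G : WeightedGraph V) (z : Set V) {n : ℕ}

theorem WeightedGraph.layer_spec (n : ℕ) (x : V) :
    n ≤ G.layer z n x ∨ ∃ p : ℕ → V, p 0 = x ∧
      (∀ i < G.layer z n x, 0 < G.w (p i) (p (i + 1))) ∧ p (G.layer z n x) ∈ z :=
  Nat.sInf_mem (s := {k | n ≤ k ∨ ∃ p : ℕ → V, p 0 = x ∧
    (∀ i < k, 0 < G.w (p i) (p (i + 1))) ∧ p k ∈ z}) ⟨n, Or.inl le_rfl⟩

theorem WeightedGraph.layer_le (n : ℕ) (x : V) : G.layer z n x ≤ n :=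
  Nat.sInf_le (Or.inl le_rfl)

theorem WeightedGraph.layer_of_mem {x : V} (hx : x ∈ z) : G.layer z n x = 0 :=
  Nat.le_zero.1 (Nat.sInf_le (Or.inr ⟨fun _ => x, rfl, by simp, hx⟩))

theorem WeightedGraph.layer_pos (hn : 0 < n) {x : V} (hx : x ∉ z) : 0 < G.layer z n x := by
  by_contra! h0
  have h := G.layer_spec z n x
  rw [Nat.le_zero.1 h0] at h
  rcases h with h | ⟨p, h1, -, h2⟩
  · omega
  · exact hx (h1 ▸ h2)

theorem WeightedGraph.layer_eq_of_distGE {o : V} (h : G.distGE o z n) : G.layer z n o = n := by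
  refine le_antisymm (G.layer_le z n o) ?_
  rcases G.layer_spec z n o with h' | ⟨p, h0, h1, h2⟩
  · exact h'
  · exact h _ p h0 h1 h2

theorem WeightedGraph.layer_le_succ {x y : V} (hxy : 0 < G.w x y) :
    G.layer z n x ≤ G.layer z n y + 1 := by
  refine Nat.sInf_le ?_
  rcases G.layer_spec z n y with h | ⟨p, h0, h1, h2⟩
  · exact Or.inl (h.trans (Nat.le_succ _))
  · refine Or.inr ⟨fun i => Nat.casesOn i x p, rfl, ?_, h2⟩
    rintro (_ | i) hi
    · simpa [h0] using hxy
    · exact h1 i (by omega)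

theorem rpow_eq_rpow_sub_one_mul {c r : ℝ} (hc : 0 ≤ c) (hr : 2 ≤ r) :
    c ^ r = c ^ (r - 1) * c := by
  nth_rewrite 3 [← Real.rpow_one c]
  rw [← Real.rpow_add' hc (by linarith)]
  simp

theorem rpow_sub_one_mul_add_le {a b r : ℝ} (ha : 0 ≤ a) (hb : 0 ≤ b) (hr : 2 ≤ r) :
    a ^ (r - 1) * b + b ^ (r - 1) * a ≤ a ^ r + b ^ r := by
  rw [rpow_eq_rpow_sub_one_mul ha hr, rpow_eq_rpow_sub_one_mul hb hr]
  rcases le_total a b with h | h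
  · have := Real.rpow_le_rpow ha h (by linarith : 0 ≤ r - 1)
    nlinarith
  · have := Real.rpow_le_rpow hb h (by linarith : 0 ≤ r - 1)
    nlinarith

/-- If `M` bounds the growth of the `r`-th power energy over one layer, then the `r`-th power of the
Laplace transform of the hitting time decays like `M ^ n`. -/
theorem WeightedGraph.laplace_rpow_le {o : V} {κ r M : ℝ} (hn : 2 ≤ n) (ho : G.distGE o z n)
    (hz : G.setWeight z < ⊤) (hκ : 1 < κ) (hr : 2 ≤ r) (hM0 : 0 ≤ M) (hM1 : M ≤ 1)
    (hM : ∀ a b : ℝ, 0 ≤ a → 0 ≤ b →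
      a ^ (r - 1) * b + M * (b ^ (r - 1) * a) ≤ κ * (a ^ r + M * b ^ r)) :
    G.vw o * ENNReal.ofReal ((κ - 1) * (G.laplace z (ENNReal.ofReal κ⁻¹) o).toReal ^ r)
      ≤ G.setWeight z * ENNReal.ofReal (M ^ (n - 2)) := by
  have hκ0 : 0 < κ := by linarith
  set θ := ENNReal.ofReal κ⁻¹ with hθ
  have hθ1 : θ < 1 := by
    rw [hθ, ENNReal.ofReal_lt_one]
    exact inv_lt_one_of_one_lt₀ hκ
  set f : V → ℝ := fun x => (G.laplace z θ x).toReal with hf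
  have hfe : ∀ x, ENNReal.ofReal (f x) = G.laplace z θ x := fun x =>
    ENNReal.ofReal_toReal ((G.laplace_le_one z hθ1.le x).trans_lt ENNReal.one_lt_top).ne
  have hf0 : ∀ x, 0 ≤ f x := fun x => ENNReal.toReal_nonneg
  have hf1 : ∀ x, f x ≤ 1 := fun x =>
    ENNReal.toReal_le_of_le_ofReal zero_le_one (by simpa using G.laplace_le_one z hθ1.le x)
  have hr0 : ∀ x, 0 ≤ f x ^ r := fun x => Real.rpow_nonneg (hf0 x) _
  have hr1 : ∀ x, f x ^ (r - 1) ≤ 1 := fun x => Real.rpow_le_one (hf0 x) (hf1 x) (by linarith)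
  have hr2 : ∀ x, 0 ≤ f x ^ (r - 1) := fun x => Real.rpow_nonneg (hf0 x) _
  set d := G.layer z n
  set m : V → ℝ := fun x => M ^ (n - 1 - d x) with hm
  have hm0 : ∀ x, 0 ≤ m x := fun x => pow_nonneg hM0 _
  have hm1 : ∀ x, m x ≤ 1 := fun x => pow_le_one₀ hM0 hM1
  have hdo : d o = n := G.layer_eq_of_distGE z ho
  set A : V → V → ℝ := fun x y => if x ∈ z then 0 else m x * (f x ^ (r - 1) * f y) with hA
  set B : V → ℝ := fun x => if x ∈ z then 0 else κ * (m x * f x ^ r) with hB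
  set loss : V → ℝ := fun x => if x = o then (κ - 1) * f o ^ r else 0 with hloss
  set gain : V → ℝ := fun x => if x ∈ z then M ^ (n - 2) else 0 with hgain
  have hA0 : ∀ x y, 0 ≤ A x y := fun x y => by
    simp only [hA]; split_ifs
    · exact le_rfl
    · exact mul_nonneg (hm0 x) (mul_nonneg (hr2 x) (hf0 y))
  have hB0 : ∀ x, 0 ≤ B x := fun x => by
    simp only [hB]; split_ifs
    · exact le_rfl
    · exact mul_nonneg hκ0.le (mul_nonneg (hm0 x) (hr0 x))
  have hloss0 : ∀ x, 0 ≤ loss x := fun x => by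
    simp only [hloss]; split_ifs
    · exact mul_nonneg (by linarith) (hr0 o)
    · exact le_rfl
  have hgain0 : ∀ x, 0 ≤ gain x := fun x => by
    simp only [hgain]; split_ifs
    · exact pow_nonneg hM0 _
    · exact le_rfl
  have hloss_le : ∀ x, n - 1 ≤ d x → loss x ≤ (κ - 1) * (m x * f x ^ r) := by
    intro x hx
    have : m x = 1 := by simp only [hm, Nat.sub_eq_zero_of_le hx, pow_zero]
    simp only [hloss, this, one_mul]
    split_ifs with h
    · rw [h]
    · exact mul_nonneg (by linarith) (hr0 x)
  have hloss_zero : ∀ x, d x < n → loss x = 0 := by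
    intro x hx
    have : x ≠ o := by rintro rfl; omega
    simp [hloss, this]
  have hloss_le' : ∀ x, loss x ≤ (κ - 1) * (m x * f x ^ r) := by
    intro x
    by_cases hx : n - 1 ≤ d x
    · exact hloss_le x hx
    · rw [hloss_zero x (by omega)]
      exact mul_nonneg (by linarith) (mul_nonneg (hm0 x) (hr0 x))
  have hsame : ∀ x y, x ∉ z → y ∉ z → m x = m y →
      A x y + A y x + (loss x + loss y) ≤ B x + B y + (gain x + gain y) := by
    intro x y hx hy hxy
    have h1 := rpow_sub_one_mul_add_le (hf0 x) (hf0 y) hr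
    have h2 := hloss_le' x
    have h3 := hloss_le' y
    simp only [hA, hB, hgain, hx, hy, if_false]
    rw [← hxy] at h3 ⊢
    nlinarith [mul_le_mul_of_nonneg_left h1 (hm0 x)]
  have hstep : ∀ x y, 0 < G.w x y → d y ≤ d x →
      A x y + A y x + (loss x + loss y) ≤ B x + B y + (gain x + gain y) := by
    intro x y hxy hle
    have hd : d x ≤ d y + 1 := G.layer_le_succ z hxy
    have hdn : d x ≤ n := G.layer_le z n x
    by_cases hx : x ∈ z
    · have hdx : d x = 0 := G.layer_of_mem z hx
      have hy : y ∈ z := by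
        by_contra hy
        have : 0 < d y := G.layer_pos z (by omega) hy
        omega
      have hdy : d y = 0 := G.layer_of_mem z hy
      rw [hloss_zero x (by omega), hloss_zero y (by omega)]
      simp only [hA, hB, hx, hy, if_true, add_zero, zero_add]
      exact add_nonneg (hgain0 x) (hgain0 y)
    have hdx : 0 < d x := G.layer_pos z (by omega) hx
    by_cases hy : y ∈ z
    · have hdy : d y = 0 := G.layer_of_mem z hy
      rw [hloss_zero x (by omega), hloss_zero y (by omega)]
      have hdx1 : d x = 1 := by omega
      simp only [hA, hB, hgain, hx, hy, if_true, if_false, add_zero, zero_add]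
      have hmx : m x = M ^ (n - 2) := by simp only [hm, hdx1]; congr 1
      have h1 : f x ^ (r - 1) * f y ≤ 1 := mul_le_one₀ (hr1 x) (hf0 y) (hf1 y)
      have h2 : 0 ≤ κ * (m x * f x ^ r) := mul_nonneg hκ0.le (mul_nonneg (hm0 x) (hr0 x))
      rw [← hmx]
      nlinarith [mul_le_mul_of_nonneg_left h1 (hm0 x)]
    have hdy : 0 < d y := G.layer_pos z (by omega) hy
    rcases hle.eq_or_lt with heq | hlt
    · exact hsame x y hx hy (by simp only [hm, heq])
    by_cases hxn : d x = n
    · refine hsame x y hx hy ?_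
      have : d y = n - 1 := by omega
      simp only [hm, this, hxn]
      congr 1
      omega
    · rw [hloss_zero x (by omega), hloss_zero y (by omega)]
      have hmy : m y = M * m x := by
        simp only [hm, ← pow_succ']
        congr 1
        omega
      simp only [hA, hB, hgain, hx, hy, if_false, hmy]
      nlinarith [mul_le_mul_of_nonneg_left (hM (f x) (f y) (hf0 x) (hf0 y)) (hm0 x)]
  have hpt : ∀ x y, 0 < G.w x y →
      A x y + A y x + (loss x + loss y) ≤ B x + B y + (gain x + gain y) := by
    intro x y hxy
    rcases le_total (d y) (d x) with h | h
    · exact hstep x y hxy h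
    · linarith [hstep y x (G.symm x y ▸ hxy) h]
  have hAB : ∀ x, ∑' y, G.w x y * ENNReal.ofReal (A x y) = G.vw x * ENNReal.ofReal (B x) := by
    intro x
    by_cases hx : x ∈ z
    · simp [hA, hB, hx]
    · have h1 : ∀ y, G.w x y * ENNReal.ofReal (A x y)
          = ENNReal.ofReal (m x * f x ^ (r - 1)) * (G.w x y * G.laplace z θ y) := by
        intro y
        simp only [hA, hx, if_false]
        rw [← mul_assoc (m x), ENNReal.ofReal_mul (mul_nonneg (hm0 x) (hr2 x)), hfe]
        ring
      have h2 : ENNReal.ofReal κ * θ = 1 := by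
        rw [hθ, ← ENNReal.ofReal_mul hκ0.le, mul_inv_cancel₀ hκ0.ne', ENNReal.ofReal_one]
      have h3 : ∑' y, G.w x y * G.laplace z θ y
          = ENNReal.ofReal κ * (G.vw x * G.laplace z θ x) := by
        rw [G.laplace_of_notMem z hx, ← mul_assoc, h2, one_mul]
      simp only [h1, ENNReal.tsum_mul_left]
      rw [h3, ← hfe x]
      simp only [hB, hx, if_false]
      rw [rpow_eq_rpow_sub_one_mul (hf0 x) hr, ← mul_assoc (m x), mul_comm κ, ENNReal.ofReal_mul
        (mul_nonneg (mul_nonneg (hm0 x) (hr2 x)) (hf0 x)), ENNReal.ofReal_mul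
        (mul_nonneg (hm0 x) (hr2 x))]
      ring
  have hBfin : ∑' x, G.vw x * ENNReal.ofReal (B x) ≠ ⊤ := by
    refine ne_top_of_le_ne_top (b := ENNReal.ofReal κ * ∑' x, G.vw x * G.laplace z θ x)
      (ENNReal.mul_lt_top ENNReal.ofReal_lt_top (G.tsum_vw_mul_laplace_lt_top z hθ1 hz)).ne ?_
    rw [← ENNReal.tsum_mul_left]
    refine ENNReal.tsum_le_tsum fun x => ?_
    rw [mul_left_comm, ← hfe, ← ENNReal.ofReal_mul hκ0.le]
    gcongr
    simp only [hB]
    split_ifs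
    · exact mul_nonneg hκ0.le (hf0 x)
    · have h1 : f x ^ r ≤ f x := by
        rw [rpow_eq_rpow_sub_one_mul (hf0 x) hr]
        exact mul_le_of_le_one_left (hf0 x) (hr1 x)
      gcongr
      exact (mul_le_of_le_one_left (hr0 x) (hm1 x)).trans h1
  have hsymm : ∀ F : V → ℝ, (∀ x, 0 ≤ F x) →
      ∑' x, ∑' y, G.w x y * ENNReal.ofReal (F x + F y)
        = 2 * ∑' x, G.vw x * ENNReal.ofReal (F x) := by
    intro F hF
    have h1 : ∑' x, ∑' y, G.w x y * ENNReal.ofReal (F y) = ∑' x, G.vw x * ENNReal.ofReal (F x) := by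
      rw [ENNReal.tsum_comm]
      refine tsum_congr fun y => ?_
      simp only [G.symm _ y, ENNReal.tsum_mul_right, WeightedGraph.vw]
    simp only [ENNReal.ofReal_add (hF _) (hF _), mul_add, ENNReal.tsum_add]
    rw [h1, two_mul]
    simp only [ENNReal.tsum_mul_right, WeightedGraph.vw]
  have hsymmA : ∑' x, ∑' y, G.w x y * ENNReal.ofReal (A x y + A y x)
      = 2 * ∑' x, G.vw x * ENNReal.ofReal (B x) := by
    have h1 : ∑' x, ∑' y, G.w x y * ENNReal.ofReal (A y x)
        = ∑' x, ∑' y, G.w x y * ENNReal.ofReal (A x y) := by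
      rw [ENNReal.tsum_comm]
      simp only [fun x y => G.symm y x]
    simp only [ENNReal.ofReal_add (hA0 _ _) (hA0 _ _), mul_add, ENNReal.tsum_add]
    rw [h1, two_mul]
    simp only [hAB]
  have hsum : ∑' x, ∑' y, G.w x y * ENNReal.ofReal (A x y + A y x)
      + ∑' x, ∑' y, G.w x y * ENNReal.ofReal (loss x + loss y)
      ≤ ∑' x, ∑' y, G.w x y * ENNReal.ofReal (B x + B y)
      + ∑' x, ∑' y, G.w x y * ENNReal.ofReal (gain x + gain y) := by
    simp only [← ENNReal.tsum_add, ← mul_add]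
    refine ENNReal.tsum_le_tsum fun x => ENNReal.tsum_le_tsum fun y => ?_
    rcases eq_or_ne (G.w x y) 0 with h | h
    · simp [h]
    · rw [← ENNReal.ofReal_add (add_nonneg (hA0 _ _) (hA0 _ _)) (add_nonneg (hloss0 _) (hloss0 _)),
        ← ENNReal.ofReal_add (add_nonneg (hB0 _) (hB0 _)) (add_nonneg (hgain0 _) (hgain0 _))]
      gcongr G.w x y * ENNReal.ofReal ?_
      exact hpt x y (pos_iff_ne_zero.2 h)
  rw [hsymmA, hsymm B hB0, hsymm loss hloss0, hsymm gain hgain0] at hsum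
  have hfin := ENNReal.mul_ne_top (ENNReal.ofNat_ne_top (n := 2)) hBfin
  rw [ENNReal.add_le_add_iff_left hfin,
    ENNReal.mul_le_mul_iff_right two_ne_zero ENNReal.ofNat_ne_top] at hsum
  have h1 : ∑' x, G.vw x * ENNReal.ofReal (loss x)
      = G.vw o * ENNReal.ofReal ((κ - 1) * f o ^ r) := by
    rw [tsum_eq_single o fun x hx => by simp [hloss, hx]]
    simp [hloss]
  have h2 : ∑' x, G.vw x * ENNReal.ofReal (gain x)
      = G.setWeight z * ENNReal.ofReal (M ^ (n - 2)) := by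
    rw [WeightedGraph.setWeight, tsum_subtype z G.vw, ← ENNReal.tsum_mul_right]
    refine tsum_congr fun x => ?_
    by_cases hx : x ∈ z <;> simp [hgain, hx]
  rwa [h1, h2] at hsum

end Energy

section Decay

theorem sinh_le_mul_cosh {x : ℝ} (hx : 0 ≤ x) : Real.sinh x ≤ x * Real.cosh x := by
  have hd : ∀ y : ℝ, HasDerivAt (fun y => y * Real.cosh y - Real.sinh y) (y * Real.sinh y) y := by
    intro y
    exact (((hasDerivAt_id' y).mul (Real.hasDerivAt_cosh y)).sub
      (Real.hasDerivAt_sinh y)).congr_deriv (by ring)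
  have hmono : MonotoneOn (fun y => y * Real.cosh y - Real.sinh y) (Set.Ici 0) := by
    refine monotoneOn_of_deriv_nonneg (convex_Ici 0)
      (fun y _ => (hd y).continuousAt.continuousWithinAt)
      (fun y _ => (hd y).differentiableAt.differentiableWithinAt) fun y hy => ?_
    rw [(hd y).deriv]
    have hy0 : 0 ≤ y := by simpa using interior_subset hy
    exact mul_nonneg hy0 (Real.sinh_nonneg_iff.2 hy0)
  have h := hmono Set.self_mem_Ici hx hx
  simp only [Real.sinh_zero, zero_mul, sub_zero] at h
  linarith

theorem cosh_le_cosh_mul_exp {s v : ℝ} (hv : |v| ≤ s) :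
    Real.cosh s ≤ Real.cosh v * Real.exp ((s ^ 2 - v ^ 2) / 2) := by
  have hd : ∀ y : ℝ, HasDerivAt (fun y => Real.cosh y * Real.exp (-(y ^ 2 / 2)))
      ((Real.sinh y - y * Real.cosh y) * Real.exp (-(y ^ 2 / 2))) y := by
    intro y
    exact ((Real.hasDerivAt_cosh y).mul
      (((hasDerivAt_pow 2 y).div_const 2).neg.exp)).congr_deriv (by simp; ring)
  have hanti : AntitoneOn (fun y => Real.cosh y * Real.exp (-(y ^ 2 / 2))) (Set.Ici 0) := by
    refine antitoneOn_of_deriv_nonpos (convex_Ici 0)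
      (fun y _ => (hd y).continuousAt.continuousWithinAt)
      (fun y _ => (hd y).differentiableAt.differentiableWithinAt) fun y hy => ?_
    rw [(hd y).deriv]
    have hy0 : 0 ≤ y := by simpa using interior_subset hy
    exact mul_nonpos_of_nonpos_of_nonneg (by linarith [sinh_le_mul_cosh hy0]) (Real.exp_nonneg _)
  have h := hanti (abs_nonneg v) ((abs_nonneg v).trans hv) hv
  simp only [Real.cosh_abs, sq_abs] at h
  calc Real.cosh s
      = Real.cosh s * Real.exp (-(s ^ 2 / 2)) * Real.exp (s ^ 2 / 2) := by
        rw [mul_assoc, ← Real.exp_add]; simp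
    _ ≤ Real.cosh v * Real.exp (-(v ^ 2 / 2)) * Real.exp (s ^ 2 / 2) := by gcongr
    _ = _ := by rw [mul_assoc, ← Real.exp_add]; ring_nf

/-- A biased walk has the best decay rate of the `r`-th power energy over one layer. -/
theorem rpow_mul_le_exp_mul {lam η u : ℝ} (hlam : 0 < lam) (hη0 : 0 ≤ η) (hη1 : η < 1)
    (hu : 0 ≤ u) :
    u ^ (2 / (1 - η) - 1) * (1 - Real.exp lam * u)
      ≤ Real.exp (-(2 / (1 - η) * √(2 * lam * (1 - η ^ 2)))) * (Real.exp lam - u) := by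
  set r := 2 / (1 - η) with hr
  set κ := Real.exp lam with hκ
  have hκ1 : 1 < κ := Real.one_lt_exp_iff.2 hlam
  have h1η : 0 < 1 - η := by linarith
  have hr2 : 2 ≤ r := by rw [hr, le_div_iff₀ h1η]; linarith
  have hrη : r - 2 = r * η := by rw [hr]; field_simp; ring
  set M := Real.exp (-(r * √(2 * lam * (1 - η ^ 2)))) with hM
  have hM0 : 0 < M := Real.exp_pos _
  have hM1 : M ≤ 1 := by
    rw [hM, Real.exp_le_one_iff]
    have : 0 ≤ r * √(2 * lam * (1 - η ^ 2)) := by positivity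
    linarith
  rcases hu.eq_or_lt with rfl | hu0
  · rw [Real.zero_rpow (by linarith)]
    nlinarith
  by_cases hκu : 1 ≤ κ * u
  · rcases le_total u κ with huκ | huκ
    · have h1 : 0 ≤ u ^ (r - 1) := Real.rpow_nonneg hu _
      nlinarith [mul_nonneg h1 (by linarith : 0 ≤ κ * u - 1),
        mul_nonneg hM0.le (by linarith : 0 ≤ κ - u)]
    · have h1 : 1 ≤ u ^ (r - 1) := Real.one_le_rpow (by linarith) (by linarith)
      have h2 : M * (u - κ) ≤ 1 * (u - κ) := mul_le_mul_of_nonneg_right hM1 (by linarith)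
      have h3 : 1 * (κ * u - 1) ≤ u ^ (r - 1) * (κ * u - 1) :=
        mul_le_mul_of_nonneg_right h1 (by linarith)
      nlinarith
  push Not at hκu
  have hu1 : u < 1 := by nlinarith
  set b := (1 - κ * u) / (κ - u) with hb
  have hκu' : 0 < κ - u := by linarith
  have hb0 : 0 < b := div_pos (by linarith) hκu'
  have hb1 : b < 1 := by rw [hb, div_lt_one hκu']; nlinarith
  have hbeq : b * (κ - u) = 1 - κ * u := div_mul_cancel₀ _ hκu'.ne'
  rw [← hbeq, ← mul_assoc]
  refine mul_le_mul_of_nonneg_right ?_ hκu'.le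
  set s := -(Real.log u + Real.log b) / 2 with hs
  set v := (Real.log u - Real.log b) / 2 with hv
  have hlu : Real.log u = v - s := by rw [hs, hv]; ring
  have hlb : Real.log b = -v - s := by rw [hs, hv]; ring
  have hue : u = Real.exp (v - s) := by rw [← hlu, Real.exp_log hu0]
  have hbe : b = Real.exp (-v - s) := by rw [← hlb, Real.exp_log hb0]
  have hlu0 : v - s < 0 := hlu ▸ Real.log_neg hu0 hu1
  have hlb0 : -v - s < 0 := hlb ▸ Real.log_neg hb0 hb1
  have hvs : |v| ≤ s := abs_le.2 ⟨by linarith, by linarith⟩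
  have hcosh : Real.cosh s = κ * Real.cosh v := by
    have h1 : κ * (u + b) = 1 + u * b := by linarith
    rw [hue, hbe] at h1
    rw [Real.cosh_eq, Real.cosh_eq]
    have h2 : Real.exp (v - s) * Real.exp s = Real.exp v := by rw [← Real.exp_add]; ring_nf
    have h3 : Real.exp (-v - s) * Real.exp s = Real.exp (-v) := by rw [← Real.exp_add]; ring_nf
    have h4 : Real.exp (v - s) * Real.exp (-v - s) * Real.exp s = Real.exp (-s) := by
      rw [← Real.exp_add, ← Real.exp_add]; ring_nf
    linear_combination -(Real.exp s / 2) * h1 + κ / 2 * h2 + κ / 2 * h3 - 1 / 2 * h4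
  have hlam2 : 2 * lam ≤ s ^ 2 - v ^ 2 := by
    have h1 := cosh_le_cosh_mul_exp hvs
    rw [hcosh, mul_comm] at h1
    have h2 := le_of_mul_le_mul_left h1 (Real.cosh_pos v)
    rw [hκ, Real.exp_le_exp] at h2
    linarith
  have hroot : √(2 * lam * (1 - η ^ 2)) ≤ s - η * v := by
    have hs0 : 0 < s := by linarith
    have h1 : η * v ≤ s := by
      have := le_abs_self v
      have := abs_nonneg v
      nlinarith
    refine Real.sqrt_le_iff.2 ⟨by linarith, ?_⟩
    have h2 : 2 * lam * (1 - η ^ 2) ≤ (s ^ 2 - v ^ 2) * (1 - η ^ 2) :=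
      mul_le_mul_of_nonneg_right hlam2 (by nlinarith)
    nlinarith [sq_nonneg (v - η * s)]
  rw [Real.rpow_def_of_pos hu0, hlu, hbe, ← Real.exp_add, hM, Real.exp_le_exp]
  have : r * √(2 * lam * (1 - η ^ 2)) ≤ r * (s - η * v) := by gcongr
  linear_combination this + v * hrη

theorem rpow_mul_add_le {lam η a b : ℝ} (hlam : 0 < lam) (hη0 : 0 ≤ η) (hη1 : η < 1)
    (ha : 0 ≤ a) (hb : 0 ≤ b) :
    a ^ (2 / (1 - η) - 1) * b + Real.exp (-(2 / (1 - η) * √(2 * lam * (1 - η ^ 2)))) *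
        (b ^ (2 / (1 - η) - 1) * a)
      ≤ Real.exp lam * (a ^ (2 / (1 - η)) +
        Real.exp (-(2 / (1 - η) * √(2 * lam * (1 - η ^ 2)))) * b ^ (2 / (1 - η))) := by
  have h1 := rpow_mul_le_exp_mul hlam hη0 hη1 (div_nonneg ha hb)
  have hr2 : 2 ≤ 2 / (1 - η) := by rw [le_div_iff₀ (by linarith)]; linarith
  set r := 2 / (1 - η)
  set M := Real.exp (-(r * √(2 * lam * (1 - η ^ 2))))
  rcases hb.eq_or_lt with rfl | hb0
  · rw [Real.zero_rpow (by linarith), Real.zero_rpow (by linarith)]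
    have := Real.rpow_nonneg ha r
    have := Real.exp_pos lam
    simp only [mul_zero, zero_mul, add_zero]
    positivity
  · rw [rpow_eq_rpow_sub_one_mul ha hr2, rpow_eq_rpow_sub_one_mul hb hr2]
    rw [Real.div_rpow ha hb] at h1
    have hbr : 0 < b ^ (r - 1) := Real.rpow_pos_of_pos hb0 _
    have h2 := mul_le_mul_of_nonneg_right h1 (mul_pos hbr hb0).le
    have h3 : a ^ (r - 1) / b ^ (r - 1) * (1 - Real.exp lam * (a / b)) * (b ^ (r - 1) * b)
        = a ^ (r - 1) * b - Real.exp lam * (a ^ (r - 1) * a) := by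
      field_simp
    have h4 : M * (Real.exp lam - a / b) * (b ^ (r - 1) * b)
        = M * (Real.exp lam * (b ^ (r - 1) * b)) - M * (b ^ (r - 1) * a) := by
      field_simp
    rw [h3, h4] at h2
    linarith

end Decay

section Upper

theorem WeightedGraph.laplace_toReal_le (G : WeightedGraph V) (z : Set V) {n : ℕ} {o : V}
    {lam η W : ℝ} (hn : 2 ≤ n) (ho : G.distGE o z n) (hlam : 0 < lam) (hη0 : 0 ≤ η) (hη1 : η < 1)
    (hW0 : 0 < W) (hW : G.setWeight z / G.vw o < ENNReal.ofReal W) :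
    (G.laplace z (ENNReal.ofReal (Real.exp lam)⁻¹) o).toReal
      ≤ Real.exp ((1 - η) / 2 * Real.log (W / lam) - (n - 2) * √(2 * lam * (1 - η ^ 2))) := by
  have h1η : 0 < 1 - η := by linarith
  have hzW : G.setWeight z < G.vw o * ENNReal.ofReal W := by
    rw [mul_comm]
    exact (ENNReal.div_lt_iff (Or.inl (G.vw_ne_zero o)) (Or.inl (G.vw_ne_top o))).1 hW
  have hM : ∀ {x : ℝ}, 0 ≤ x → Real.exp (-x) ≤ 1 := fun hx => Real.exp_le_one_iff.2 (by linarith)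
  have h := G.laplace_rpow_le z hn ho hzW.lt_top (Real.one_lt_exp_iff.2 hlam)
    (by rw [le_div_iff₀ h1η]; linarith) (Real.exp_nonneg _)
    (hM (mul_nonneg (div_nonneg zero_le_two h1η.le) (Real.sqrt_nonneg _)))
    fun a b ha hb => rpow_mul_add_le hlam hη0 hη1 ha hb
  set F := (G.laplace z (ENNReal.ofReal (Real.exp lam)⁻¹) o).toReal
  set R := √(2 * lam * (1 - η ^ 2))
  have hF : 0 ≤ F := ENNReal.toReal_nonneg
  rcases hF.eq_or_lt with hF0 | hF0
  · rw [← hF0]; positivity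
  have h2 : (Real.exp lam - 1) * F ^ (2 / (1 - η))
      ≤ W * Real.exp (-(2 / (1 - η) * R)) ^ (n - 2) := by
    have h3 := h.trans (mul_le_mul_left hzW.le _)
    rw [mul_assoc, ENNReal.mul_le_mul_iff_right (G.vw_ne_zero o) (G.vw_ne_top o),
      ← ENNReal.ofReal_mul hW0.le] at h3
    exact (ENNReal.ofReal_le_ofReal_iff (by positivity)).1 h3
  have h4 : lam * F ^ (2 / (1 - η)) ≤ W * Real.exp (-(2 / (1 - η) * R)) ^ (n - 2) := by
    refine le_trans ?_ h2
    gcongr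
    linarith [Real.add_one_le_exp lam]
  have h5 := Real.log_le_log (by positivity) h4
  rw [Real.log_mul hlam.ne' (by positivity), Real.log_rpow hF0, Real.log_mul hW0.ne' (by positivity),
    Real.log_pow, Real.log_exp, Nat.cast_sub hn] at h5
  rw [← Real.exp_log hF0, Real.exp_le_exp, Real.log_div hW0.ne' hlam.ne']
  have h6 := mul_le_mul_of_nonneg_left h5 (by linarith : 0 ≤ (1 - η) / 2)
  have h7 : (1 - η) / 2 * (Real.log lam + 2 / (1 - η) * Real.log F)
      = (1 - η) / 2 * Real.log lam + Real.log F := by field_simp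
  have h8 : (1 - η) / 2 * (Real.log W + ((n : ℝ) - (2 : ℕ)) * -(2 / (1 - η) * R))
      = (1 - η) / 2 * Real.log W - (n - 2) * R := by field_simp; push_cast; ring
  rw [h7, h8] at h6
  linarith

theorem tendsto_log_natCast : Tendsto (fun n : ℕ => Real.log n) atTop atTop :=
  Real.tendsto_log_atTop.comp tendsto_natCast_atTop_atTop

theorem eventually_laplace_le {c p S ε : ℝ} (hc : 0 < c) (hp : 0 < p) (hS : (p + 2) / 2 < S)
    (hε : 0 < ε) :
    ∀ᶠ n : ℕ in atTop, ∀ (G : WeightedGraph V) (o : V) (z : Set V), G.distGE o z n →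
      G.setWeight z / G.vw o < ENNReal.ofReal (c * (n : ℝ) ^ p) →
      G.laplace z (ENNReal.ofReal
          (Real.exp ((S ^ 2 - (p + 2) ^ 2 / 4) / 2 * (Real.log n / n) ^ 2))⁻¹) o
        ≤ ENNReal.ofReal (Real.exp (((p + 2) / 2 - S + ε) * Real.log n)) := by
  have hS0 : 0 < S := by linarith
  set m := (S ^ 2 - (p + 2) ^ 2 / 4) / 2 with hm
  have hm0 : 0 < m := by rw [hm]; nlinarith
  set η := (p + 2) / (2 * S) with hη
  have hη0 : 0 ≤ η := by positivity
  have hη1 : η < 1 := by rw [hη, div_lt_one (by positivity)]; linarith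
  have hev1 : ∀ᶠ n : ℕ in atTop, (1 - η) / 2 * (Real.log c - Real.log m) ≤ ε / 2 * Real.log n :=
    (tendsto_log_natCast.const_mul_atTop (half_pos hε)).eventually_ge_atTop _
  have hev2 : ∀ᶠ n : ℕ in atTop, 4 * m / S ≤ ε / 2 * n :=
    (tendsto_natCast_atTop_atTop.const_mul_atTop (half_pos hε)).eventually_ge_atTop _
  have hev3 := tendsto_log_natCast.eventually_ge_atTop 1
  filter_upwards [hev1, hev2, hev3, eventually_ge_atTop 2] with n h1 h2 h3 hn G o z ho hW
  have hn0 : (0 : ℝ) < n := by positivity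
  have hl0 : 0 < Real.log n := by linarith
  have hθ : ENNReal.ofReal (Real.exp (m * (Real.log n / n) ^ 2))⁻¹ ≤ 1 := by
    rw [ENNReal.ofReal_le_one]
    exact inv_le_one_of_one_le₀ (Real.one_le_exp (by positivity))
  rw [← ENNReal.ofReal_toReal (ne_top_of_le_ne_top ENNReal.one_ne_top (G.laplace_le_one z hθ o))]
  refine ENNReal.ofReal_le_ofReal
    ((G.laplace_toReal_le z hn ho (by positivity) hη0 hη1 (by positivity) hW).trans ?_)
  rw [Real.exp_le_exp]
  have hroot : √(2 * (m * (Real.log n / n) ^ 2) * (1 - η ^ 2)) = 2 * m / S * (Real.log n / n) := by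
    rw [Real.sqrt_eq_iff_mul_self_eq_of_pos (by positivity)]
    rw [hη, hm]
    field_simp
    ring
  rw [hroot, Real.log_div (by positivity) (by positivity), Real.log_mul hc.ne' (by positivity),
    Real.log_rpow hn0, Real.log_mul hm0.ne' (by positivity), Real.log_pow,
    Real.log_div hl0.ne' hn0.ne']
  have hll : 0 ≤ (1 - η) * Real.log (Real.log n) :=
    mul_nonneg (by linarith) (Real.log_nonneg h3)
  have h4 : 4 * m / S * (Real.log n / n) ≤ ε / 2 * Real.log n := by
    calc 4 * m / S * (Real.log n / n) ≤ ε / 2 * n * (Real.log n / n) := by gcongr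
      _ = _ := by field_simp
  have h5 : ((n : ℝ) - 2) * (2 * m / S * (Real.log n / n))
      = 2 * m / S * Real.log n - 4 * m / S * (Real.log n / n) := by field_simp; ring
  have h6 : (1 - η) / 2 * (p + 2) - 2 * m / S = (p + 2) / 2 - S := by
    rw [hη, hm]; field_simp; ring
  rw [h5, ← h6]
  push_cast
  linarith

end Upper

section Path

/-- The edge weights of the half-line with conductance `c k` between `k` and `k + 1` and a loop of
weight `l k` at `k`. -/
noncomputable def pathWeight (c l : ℕ → ℝ) (x y : ℕ) : ℝ≥0∞ :=
  (if y = x + 1 then ENNReal.ofReal (c x) else 0) + (if x = y + 1 then ENNReal.ofReal (c y) else 0)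
    + if y = x then ENNReal.ofReal (l x) else 0

variable {c l : ℕ → ℝ}

theorem pathWeight_comm (x y : ℕ) : pathWeight c l x y = pathWeight c l y x := by
  rcases eq_or_ne x y with rfl | h
  · rfl
  · simp [pathWeight, h, h.symm, add_comm]

theorem le_succ_of_pathWeight_pos {x y : ℕ} (h : 0 < pathWeight c l x y) : y ≤ x + 1 := by
  by_contra! hlt
  have h1 : y ≠ x + 1 := by omega
  have h2 : x ≠ y + 1 := by omega
  have h3 : y ≠ x := by omega
  simp [pathWeight, h1, h2, h3] at h

theorem tsum_pathWeight_zero (g : ℕ → ℝ≥0∞) :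
    ∑' y, pathWeight c l 0 y * g y = ENNReal.ofReal (c 0) * g 1 + ENNReal.ofReal (l 0) * g 0 := by
  simp only [pathWeight, add_mul, ite_mul, zero_mul, ENNReal.tsum_add, tsum_ite_eq]
  simp

theorem tsum_pathWeight_succ (j : ℕ) (g : ℕ → ℝ≥0∞) :
    ∑' y, pathWeight c l (j + 1) y * g y = ENNReal.ofReal (c (j + 1)) * g (j + 2)
      + ENNReal.ofReal (c j) * g j + ENNReal.ofReal (l (j + 1)) * g (j + 1) := by
  simp only [pathWeight, add_mul, ite_mul, zero_mul, ENNReal.tsum_add, tsum_ite_eq,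
    Nat.add_right_cancel_iff]
  congr 2
  simp_rw [eq_comm (a := j)]
  rw [tsum_ite_eq j fun y => ENNReal.ofReal (c y) * g y]

theorem tsum_pathWeight_zero_one :
    ∑' y, pathWeight c l 0 y = ENNReal.ofReal (c 0) + ENNReal.ofReal (l 0) := by
  simpa using tsum_pathWeight_zero (c := c) (l := l) fun _ => 1

theorem tsum_pathWeight_succ_one (j : ℕ) :
    ∑' y, pathWeight c l (j + 1) y
      = ENNReal.ofReal (c (j + 1)) + ENNReal.ofReal (c j) + ENNReal.ofReal (l (j + 1)) := by
  simpa using tsum_pathWeight_succ (c := c) (l := l) j fun _ => 1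

/-- The weighted graph on the half-line given by `pathWeight`. -/
noncomputable def pathGraph (c l : ℕ → ℝ) (h0 : 0 < c 0)
    (h : ∀ j, 0 < c (j + 1) ∨ 0 < c j ∨ 0 < l (j + 1)) : WeightedGraph ℕ where
  w := pathWeight c l
  symm := pathWeight_comm
  vw_pos := by
    rintro (_ | j)
    · rw [tsum_pathWeight_zero_one]
      simp [h0]
    · rw [tsum_pathWeight_succ_one]
      simpa [or_assoc] using h j
  vw_lt_top := by
    rintro (_ | j)
    · rw [tsum_pathWeight_zero_one]
      simp
    · rw [tsum_pathWeight_succ_one]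
      simp

theorem exists_weightedGraph_le_laplace {κ γ ρ : ℝ} (hκ : 1 < κ) (hκ' : κ ≤ 3 / 2) (hγ : 0 < γ)
    (hκρ : κ ≤ ρ) (h : κ * (γ + 1) * ρ = γ * ρ ^ 2 + 1) (m : ℕ) :
    ∃ G : WeightedGraph ℕ, G.distGE 0 {m + 2} (m + 2) ∧
      G.setWeight {m + 2} / G.vw 0 ≤ ENNReal.ofReal (4 * γ ^ m * (κ - 1)) ∧
      ENNReal.ofReal (1 / 2 * (ρ ^ (m + 1))⁻¹) ≤ G.laplace {m + 2} (ENNReal.ofReal κ⁻¹) 0 := by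
  have hκ0 : 0 < κ := by linarith
  have hκ1 : 0 < κ - 1 := by linarith
  have hρ1 : 0 < ρ - 1 := by linarith
  have hρ0 : 0 < ρ := by linarith
  have hρinv : ρ⁻¹ < 1 := inv_lt_one_of_one_lt₀ (by linarith)
  set b := 2 * (κ - ρ⁻¹) with hb
  have hb0 : 0 < b := by rw [hb]; linarith
  set c : ℕ → ℝ := fun k => if k ≤ m then γ ^ k else if k = m + 1 then b * γ ^ m else 0 with hc
  set l : ℕ → ℝ := fun k =>
    if k = 0 then (ρ - 1) / (κ - 1) - 1 else if k ≤ m + 2 then 0 else 1 with hl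
  have hc_nonneg : ∀ k, 0 ≤ c k := fun k => by simp only [hc]; split_ifs <;> positivity
  have hl_nonneg : ∀ k, 0 ≤ l k := fun k => by
    simp only [hl]
    split_ifs
    · rw [sub_nonneg, one_le_div hκ1]; linarith
    · exact le_rfl
    · exact zero_le_one
  have hc_le : ∀ {k}, k ≤ m → c k = γ ^ k := fun hk => by simp [hc, hk]
  have hc_last : c (m + 1) = b * γ ^ m := by simp [hc]
  have hc_gt : c (m + 2) = 0 := by simp [hc]
  have hl_zero : l 0 = (ρ - 1) / (κ - 1) - 1 := by simp [hl]
  have hl_mid : ∀ {k}, k ≤ m + 1 → l (k + 1) = 0 := fun hk => by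
    simp [hl]; omega
  have h0 : 0 < c 0 := by simp [hc]
  have hpos : ∀ j, 0 < c (j + 1) ∨ 0 < c j ∨ 0 < l (j + 1) := by
    intro j
    rcases le_or_gt j m with hj | hj
    · right; left; rw [hc_le hj]; positivity
    rcases Nat.lt_or_ge (m + 1) j with hj' | hj'
    · right; right
      simp [hl, show ¬ j + 1 ≤ m + 2 by omega]
    · obtain rfl : j = m + 1 := by omega
      right; left; rw [hc_last]; positivity
  let G := pathGraph c l h0 hpos
  have hvw0 : G.vw 0 = ENNReal.ofReal ((ρ - 1) / (κ - 1)) := by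
    change ∑' y, pathWeight c l 0 y = _
    rw [tsum_pathWeight_zero_one, ← ENNReal.ofReal_add (hc_nonneg _) (hl_nonneg _), hl_zero,
      hc_le (Nat.zero_le m)]
    simp
  have hvw : ∀ j, G.vw (j + 1) = ENNReal.ofReal (c (j + 1) + c j + l (j + 1)) := by
    intro j
    change ∑' y, pathWeight c l (j + 1) y = _
    rw [tsum_pathWeight_succ_one, ENNReal.ofReal_add (add_nonneg (hc_nonneg _) (hc_nonneg _))
      (hl_nonneg _), ENNReal.ofReal_add (hc_nonneg _) (hc_nonneg _)]
  refine ⟨G, ?_, ?_, ?_⟩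
  · intro k p hp0 hp hk
    have hle : ∀ i ≤ k, p i ≤ i := by
      intro i
      induction i with
      | zero => intro _; simp [hp0]
      | succ i ih =>
        intro hi
        have h1 := ih (by omega)
        have h2 : p (i + 1) ≤ p i + 1 := le_succ_of_pathWeight_pos (hp i (by omega))
        omega
    have h1 := hle k le_rfl
    rw [Set.mem_singleton_iff.1 hk] at h1
    exact h1
  · have hz : G.setWeight {m + 2} = ENNReal.ofReal (b * γ ^ m) := by
      rw [WeightedGraph.setWeight, tsum_singleton (m + 2) G.vw, hvw, hc_last, hl_mid le_rfl, hc_gt]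
      simp
    rw [hz, hvw0, ← ENNReal.ofReal_div_of_pos (by positivity)]
    refine ENNReal.ofReal_le_ofReal ?_
    have h1 : b ≤ 4 * (ρ - 1) := by
      have h2 : ρ - ρ⁻¹ ≤ 2 * (ρ - 1) := by
        have h3 : ρ * ρ⁻¹ = 1 := mul_inv_cancel₀ hρ0.ne'
        nlinarith [mul_pos hρ1 hρ1, inv_pos.2 hρ0]
      rw [hb]; linarith
    rw [div_div_eq_mul_div, div_le_iff₀ hρ1]
    calc b * γ ^ m * (κ - 1) ≤ 4 * (ρ - 1) * γ ^ m * (κ - 1) := by gcongr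
      _ = _ := by ring
  · set g : ℕ → ℝ := fun k =>
      if k ≤ m + 1 then 1 / 2 * (ρ ^ k * (ρ ^ (m + 1))⁻¹) else if k = m + 2 then 1 else 0 with hg
    have hg_nonneg : ∀ k, 0 ≤ g k := fun k => by simp only [hg]; split_ifs <;> positivity
    have hg_le : ∀ {k}, k ≤ m + 1 → g k = 1 / 2 * (ρ ^ k * (ρ ^ (m + 1))⁻¹) := fun hk => by
      simp [hg, hk]
    have hg_last : g (m + 2) = 1 := by simp [hg]
    have hg_le_one : ∀ k, g k ≤ 1 := by
      intro k
      simp only [hg]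
      split_ifs with hk
      · have h1 : ρ ^ k * (ρ ^ (m + 1))⁻¹ ≤ 1 := by
          rw [← div_eq_mul_inv, div_le_one (by positivity)]
          exact pow_le_pow_right₀ (by linarith) hk
        linarith
      · exact le_rfl
      · exact zero_le_one
    have hθ : ENNReal.ofReal κ⁻¹ < 1 := ENNReal.ofReal_lt_one.2 (inv_lt_one_of_one_lt₀ hκ)
    have hkey := G.le_laplace_of_subsolution {m + 2} hθ (g := fun k => ENNReal.ofReal (g k))
      (fun k => ENNReal.ofReal_le_one.2 (hg_le_one k)) ?_ 0
    · rw [hg_le (Nat.zero_le _), pow_zero, one_mul] at hkey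
      exact hkey
    rintro (_ | j) hj
    · change _ ≤ _ * ∑' y, pathWeight c l 0 y * _
      rw [tsum_pathWeight_zero, hvw0]
      rw [← ENNReal.ofReal_mul (by positivity), ← ENNReal.ofReal_mul (hc_nonneg _),
        ← ENNReal.ofReal_mul (hl_nonneg _), ← ENNReal.ofReal_add
          (mul_nonneg (hc_nonneg _) (hg_nonneg _)) (mul_nonneg (hl_nonneg _) (hg_nonneg _)),
        ← ENNReal.ofReal_mul (by positivity)]
      refine ENNReal.ofReal_le_ofReal (le_of_eq ?_)
      rw [hl_zero, hc_le (Nat.zero_le m), hg_le (Nat.zero_le _), hg_le (by omega)]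
      field_simp
      ring
    · change _ ≤ _ * ∑' y, pathWeight c l (j + 1) y * _
      rw [tsum_pathWeight_succ, hvw]
      rw [← ENNReal.ofReal_mul
          (add_nonneg (add_nonneg (hc_nonneg _) (hc_nonneg _)) (hl_nonneg _)),
        ← ENNReal.ofReal_mul (hc_nonneg _), ← ENNReal.ofReal_mul (hc_nonneg _),
        ← ENNReal.ofReal_mul (hl_nonneg _),
        ← ENNReal.ofReal_add (mul_nonneg (hc_nonneg _) (hg_nonneg _))
          (mul_nonneg (hc_nonneg _) (hg_nonneg _)),
        ← ENNReal.ofReal_add (add_nonneg (mul_nonneg (hc_nonneg _) (hg_nonneg _))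
          (mul_nonneg (hc_nonneg _) (hg_nonneg _))) (mul_nonneg (hl_nonneg _) (hg_nonneg _)),
        ← ENNReal.ofReal_mul (by positivity)]
      refine ENNReal.ofReal_le_ofReal ?_
      rw [le_inv_mul_iff₀ hκ0]
      have hj' : j + 1 ≠ m + 2 := hj
      rcases lt_trichotomy j m with hjm | rfl | hjm
      · rw [hl_mid (by omega), hc_le (k := j + 1) hjm, hc_le hjm.le, hg_le (by omega), hg_le (by omega),
          hg_le (by omega)]
        refine le_of_eq ?_
        linear_combination (1 / 2 * γ ^ j * ρ ^ j * (ρ ^ (m + 1))⁻¹) * h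
      · rw [hl_mid (by omega), hc_last, hc_le le_rfl, hg_last, hg_le le_rfl, hg_le (by omega)]
        have h1 : ρ ^ (j + 1) * (ρ ^ (j + 1))⁻¹ = 1 := mul_inv_cancel₀ (by positivity)
        have h2 : ρ ^ j * (ρ ^ (j + 1))⁻¹ = ρ⁻¹ := by rw [pow_succ]; field_simp
        rw [h1, h2]
        have h3 : κ * (b + 1) ≤ ρ⁻¹ + 2 * b := by rw [hb]; nlinarith
        have h4 := mul_le_mul_of_nonneg_right h3 (by positivity : 0 ≤ γ ^ j / 2)
        linarith
      · have h1 : g (j + 1) = 0 := by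
          simp [hg, show ¬ j ≤ m by omega, show j ≠ m + 1 by omega]
        rw [h1, mul_zero, mul_zero]
        exact add_nonneg (add_nonneg (mul_nonneg (hc_nonneg _) (hg_nonneg _))
          (mul_nonneg (hc_nonneg _) (hg_nonneg _))) (by rw [mul_zero])

end Path

section Tauberian

/-- The total first hitting probability of the times before `τ`. -/
noncomputable def WeightedGraph.hitBefore (G : WeightedGraph V) (z : Set V) (τ : ℝ) (x : V) :
    ℝ≥0∞ :=
  ∑' k : ℕ, if (k : ℝ) < τ then G.firstHit z k x else 0

theorem ofReal_exp_inv_pow (lam : ℝ) (k : ℕ) :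
    ENNReal.ofReal (Real.exp lam)⁻¹ ^ k = ENNReal.ofReal (Real.exp (-(lam * k))) := by
  rw [← ENNReal.ofReal_pow (by positivity), ← Real.exp_neg, ← Real.exp_nat_mul]
  congr 2
  ring

theorem WeightedGraph.hitBefore_le (G : WeightedGraph V) (z : Set V) {lam τ : ℝ} (hlam : 0 ≤ lam)
    (x : V) :
    G.hitBefore z τ x ≤ ENNReal.ofReal (Real.exp (lam * τ)) *
      G.laplace z (ENNReal.ofReal (Real.exp lam)⁻¹) x := by
  rw [WeightedGraph.hitBefore, WeightedGraph.laplace, ← ENNReal.tsum_mul_left]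
  refine ENNReal.tsum_le_tsum fun k => ?_
  split_ifs with hk
  · rw [← mul_assoc, ofReal_exp_inv_pow, ← ENNReal.ofReal_mul (Real.exp_nonneg _), ← Real.exp_add]
    refine le_mul_of_one_le_left' ?_
    rw [ENNReal.one_le_ofReal, Real.one_le_exp_iff]
    nlinarith
  · exact zero_le

theorem WeightedGraph.laplace_le_add (G : WeightedGraph V) (z : Set V) {lam lam₁ lam₂ τ₁ τ₂ : ℝ}
    (hlam : 0 ≤ lam) (h₁ : lam ≤ lam₁) (h₂ : lam₂ ≤ lam) (x : V) :
    G.laplace z (ENNReal.ofReal (Real.exp lam)⁻¹) x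
      ≤ ENNReal.ofReal (Real.exp ((lam₁ - lam) * τ₁)) *
          G.laplace z (ENNReal.ofReal (Real.exp lam₁)⁻¹) x
        + ENNReal.ofReal (Real.exp (-(lam * τ₁))) * G.hitBefore z τ₂ x
        + ENNReal.ofReal (Real.exp (-((lam - lam₂) * τ₂))) *
          G.laplace z (ENNReal.ofReal (Real.exp lam₂)⁻¹) x := by
  simp only [WeightedGraph.hitBefore, WeightedGraph.laplace, ← ENNReal.tsum_mul_left,
    ← ENNReal.tsum_add, ← mul_assoc, ofReal_exp_inv_pow,
    ← ENNReal.ofReal_mul (Real.exp_nonneg _), ← Real.exp_add]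
  refine ENNReal.tsum_le_tsum fun k => ?_
  have key : ∀ {a b : ℝ}, a ≤ b → ENNReal.ofReal (Real.exp a) * G.firstHit z k x
      ≤ ENNReal.ofReal (Real.exp b) * G.firstHit z k x := fun h => by gcongr
  rcases lt_or_ge (k : ℝ) τ₁ with hk₁ | hk₁
  · exact le_add_right (le_add_right (key (by nlinarith)))
  rcases lt_or_ge (k : ℝ) τ₂ with hk₂ | hk₂
  · rw [if_pos hk₂]
    exact le_add_right (le_add_left (key (by nlinarith)))
  · exact le_add_left (key (by nlinarith))

end Tauberian

section Asymptotics

theorem tendsto_log_div_natCast : Tendsto (fun n : ℕ => Real.log n / n) atTop (nhds 0) :=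
  Real.isLittleO_log_id_atTop.tendsto_div_nhds_zero.comp tendsto_natCast_atTop_atTop

theorem eventually_le_exp_mul_log {A a b : ℝ} (hA : 0 < A) (hab : a < b) :
    ∀ᶠ n : ℕ in atTop, Real.exp (a * Real.log n) ≤ A * Real.exp (b * Real.log n) := by
  filter_upwards [(tendsto_log_natCast.const_mul_atTop (sub_pos.2 hab)).eventually_ge_atTop
    (-Real.log A)] with n hn
  rw [← Real.exp_log hA, ← Real.exp_add, Real.exp_le_exp]
  linarith

theorem eventually_mul_log_sq_lt {A c t : ℝ} (hc : 0 < c) (ht : 0 < t) :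
    ∀ᶠ n : ℕ in atTop, A * Real.log n ^ 2 < c * Real.exp (t * Real.log n) := by
  have h := (Real.tendsto_pow_mul_exp_neg_atTop_nhds_zero 2).comp
    (tendsto_log_natCast.const_mul_atTop ht)
  have h2 := h.const_mul (A / t ^ 2)
  rw [mul_zero] at h2
  filter_upwards [h2.eventually (gt_mem_nhds hc)] with n hn
  simp only [Function.comp_apply, Real.exp_neg] at hn
  rw [← div_lt_iff₀ (Real.exp_pos _)]
  convert hn using 1
  field_simp

theorem one_add_sq_div_two_le_cosh {x : ℝ} (hx : 0 ≤ x) : 1 + x ^ 2 / 2 ≤ Real.cosh x := by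
  have h1 : x / 2 ≤ Real.sinh (x / 2) := Real.self_le_sinh_iff.2 (by positivity)
  have h2 : Real.cosh x = Real.cosh (x / 2) ^ 2 + Real.sinh (x / 2) ^ 2 := by
    rw [← Real.cosh_two_mul]; ring_nf
  have h3 := Real.cosh_sq (x / 2)
  nlinarith

theorem log_cosh_div_cosh_bounds {σ ν x : ℝ} (hν : 0 ≤ ν) (hσ : ν ≤ σ) (hx : 0 ≤ x) :
    (σ ^ 2 - ν ^ 2) / 2 * x ^ 2 - σ ^ 4 / 4 * x ^ 4
        ≤ Real.log (Real.cosh (σ * x) / Real.cosh (ν * x)) ∧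
      Real.log (Real.cosh (σ * x) / Real.cosh (ν * x)) ≤ (σ ^ 2 - ν ^ 2) / 2 * x ^ 2 := by
  rw [Real.log_div (Real.cosh_pos _).ne' (Real.cosh_pos _).ne']
  constructor
  · have h1 : Real.log (Real.cosh (ν * x)) ≤ (ν * x) ^ 2 / 2 :=
      (Real.log_le_iff_le_exp (Real.cosh_pos _)).2 (Real.cosh_le_exp_half_sq _)
    set t := (σ * x) ^ 2 / 2 with ht
    have ht0 : 0 ≤ t := by positivity
    have h2 : Real.log (1 + t) ≤ Real.log (Real.cosh (σ * x)) :=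
      Real.log_le_log (by positivity) (one_add_sq_div_two_le_cosh (mul_nonneg (hν.trans hσ) hx))
    have h3 : t - t ^ 2 ≤ Real.log (1 + t) := by
      have h4 := Real.one_sub_inv_le_log_of_pos (by positivity : 0 < 1 + t)
      refine le_trans ?_ h4
      have h5 : 1 - (1 + t)⁻¹ = t / (1 + t) := by field_simp; ring
      rw [h5, le_div_iff₀ (by positivity)]
      nlinarith [pow_nonneg ht0 3]
    rw [ht] at h3
    linarith
  · have h := cosh_le_cosh_mul_exp (s := σ * x) (v := ν * x)
      (by rw [abs_of_nonneg (by positivity)]; gcongr)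
    have h2 := Real.log_le_log (Real.cosh_pos _) h
    rw [Real.log_mul (Real.cosh_pos _).ne' (Real.exp_pos _).ne', Real.log_exp] at h2
    linarith

end Asymptotics

section LowerGraph

theorem eventually_exists_weightedGraph {c p σ ν : ℝ} (hc : 0 < c) (hν : 0 < ν) (hσ : ν < σ)
    (hνp : 2 * ν < p + 2) :
    ∀ᶠ n : ℕ in atTop, ∃ G : WeightedGraph ℕ, G.distGE 0 {n} n ∧
      G.setWeight {n} / G.vw 0 < ENNReal.ofReal (c * (n : ℝ) ^ p) ∧
      ENNReal.ofReal (1 / 2 * Real.exp (-(σ - ν) * Real.log n)) ≤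
        G.laplace {n} (ENNReal.ofReal (Real.exp (Real.log
          (Real.cosh (σ * (Real.log n / n)) / Real.cosh (ν * (Real.log n / n)))))⁻¹) 0 := by
  have hσ0 : 0 < σ := hν.trans hσ
  set A := (σ ^ 2 - ν ^ 2) / 2 with hA
  have hA0 : 0 < A := by rw [hA]; nlinarith
  have hev1 : ∀ᶠ n : ℕ in atTop, A * (Real.log n / n) ^ 2 < 1 / 4 := by
    have h := (tendsto_log_div_natCast.pow 2).const_mul A
    rw [zero_pow two_ne_zero, mul_zero] at h
    exact h.eventually (gt_mem_nhds (by norm_num))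
  filter_upwards [hev1, eventually_mul_log_sq_lt (A := 8 * A) hc (sub_pos.2 hνp),
    tendsto_log_natCast.eventually_gt_atTop 0, eventually_ge_atTop 2] with n h1 h2 h3 hn
  obtain ⟨m, rfl⟩ := Nat.exists_eq_add_of_le' hn
  have hn0 : (0 : ℝ) < (m + 2 : ℕ) := by positivity
  generalize hN : ((m + 2 : ℕ) : ℝ) = N at *
  set x := Real.log N / N with hx
  have hx0 : 0 < x := by positivity
  have hNx : N * x = Real.log N := by rw [hx]; field_simp
  set κ := Real.cosh (σ * x) / Real.cosh (ν * x) with hκ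
  have hcosh := Real.cosh_pos (ν * x)
  have hvs : ν * x < σ * x := by gcongr
  have hv0 : 0 < ν * x := by positivity
  have hκ1 : 1 < κ := by
    rw [hκ, one_lt_div hcosh, Real.cosh_lt_cosh, abs_of_pos hv0, abs_of_pos (hv0.trans hvs)]
    exact hvs
  have hκ0 : 0 < κ := zero_lt_one.trans hκ1
  have hκA : κ - 1 ≤ 2 * (A * x ^ 2) := by
    have h4 := (log_cosh_div_cosh_bounds hν.le hσ.le hx0.le).2
    have h5 : κ ≤ Real.exp (A * x ^ 2) := (Real.log_le_iff_le_exp hκ0).1 h4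
    have h6 : 0 ≤ A * x ^ 2 := by positivity
    have h7 := Real.abs_exp_sub_one_le (x := A * x ^ 2) (by rw [abs_of_nonneg h6]; linarith)
    rw [abs_of_nonneg h6] at h7
    linarith [le_abs_self (Real.exp (A * x ^ 2) - 1)]
  have hcs : κ * Real.cosh (ν * x) = Real.cosh (σ * x) := div_mul_cancel₀ _ hcosh.ne'
  have e1 : Real.exp (2 * (ν * x)) = Real.exp (ν * x) ^ 2 := by rw [← Real.exp_nat_mul]; norm_num
  have e2 : Real.exp (σ * x - ν * x) = Real.exp (σ * x) * (Real.exp (ν * x))⁻¹ := by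
    rw [Real.exp_sub, div_eq_mul_inv]
  obtain ⟨G, hG1, hG2, hG3⟩ := exists_weightedGraph_le_laplace (κ := κ)
    (γ := Real.exp (2 * (ν * x))) (ρ := Real.exp (σ * x - ν * x)) hκ1 (by linarith)
    (Real.exp_pos _)
    (by
      rw [hκ, div_le_iff₀ hcosh, Real.cosh_eq, Real.cosh_eq]
      have h4 : Real.exp (σ * x - ν * x) * Real.exp (ν * x) = Real.exp (σ * x) := by
        rw [← Real.exp_add]; ring_nf
      have h5 : Real.exp (-(σ * x)) ≤ Real.exp (σ * x - ν * x) * Real.exp (-(ν * x)) := by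
        rw [← Real.exp_add, Real.exp_le_exp]; linarith
      linarith)
    (by
      rw [Real.cosh_eq, Real.cosh_eq, Real.exp_neg, Real.exp_neg] at hcs
      rw [e1, e2]
      have hE := Real.exp_pos (ν * x)
      have hF := Real.exp_pos (σ * x)
      field_simp at hcs ⊢
      linear_combination hcs) m
  refine ⟨G, hG1, hG2.trans_lt ?_,
    (ENNReal.ofReal_le_ofReal ?_).trans (hG3.trans_eq (by rw [Real.exp_log hκ0]))⟩
  · rw [ENNReal.ofReal_lt_ofReal_iff (by positivity)]
    have h4 : Real.exp (2 * (ν * x)) ^ m ≤ Real.exp (2 * ν * Real.log N) := by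
      rw [← Real.exp_nat_mul, Real.exp_le_exp, ← hNx, ← hN]
      push_cast
      nlinarith
    calc 4 * Real.exp (2 * (ν * x)) ^ m * (κ - 1)
        ≤ 4 * Real.exp (2 * ν * Real.log N) * (2 * (A * x ^ 2)) := by gcongr
      _ = 8 * A * Real.log N ^ 2 * (Real.exp (2 * ν * Real.log N) * (N ^ 2)⁻¹) := by
        rw [hx]; field_simp; norm_num
      _ < c * Real.exp ((p + 2 - 2 * ν) * Real.log N) *
          (Real.exp (2 * ν * Real.log N) * (N ^ 2)⁻¹) := by gcongr
      _ = c * N ^ p := by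
        have h5 : N ^ p * N ^ 2 = Real.exp ((p + 2 - 2 * ν) * Real.log N) *
            Real.exp (2 * ν * Real.log N) := by
          rw [← Real.exp_add, ← Real.rpow_natCast, ← Real.rpow_add hn0, Real.rpow_def_of_pos hn0]
          push_cast
          ring_nf
        rw [mul_assoc, ← mul_assoc (Real.exp _), ← h5]
        field_simp
  · gcongr
    rw [← Real.exp_nat_mul, ← Real.exp_neg, Real.exp_le_exp, ← hNx, ← hN]
    push_cast
    nlinarith

end LowerGraph

section Parameters

/-- At the endpoint `t = 0` both strict inequalities reduce to the positivity of a square. -/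
theorem exists_parameters {q α ε : ℝ} (hq : 0 < q) (hα : 0 < α) (hαq : q / 2 < 1 / α)
    (hε : 0 < ε) :
    ∃ S σ ν δ : ℝ, 0 < ν ∧ ν < q / 2 ∧ 0 < δ ∧ 1 / α < σ ∧ σ < S ∧
      (σ ^ 2 - ν ^ 2) / 2 ≤ (S ^ 2 - q ^ 2 / 4) / 2 ∧
      ((1 / α) ^ 2 - q ^ 2 / 4) / 2 ≤ (σ ^ 2 - ν ^ 2) / 2 - δ ∧
      ((S ^ 2 - q ^ 2 / 4) / 2 - (σ ^ 2 - ν ^ 2) / 2 + δ) / S + (q / 2 - S + δ) < -(σ - ν) ∧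
      -(((σ ^ 2 - ν ^ 2) / 2 - δ - ((1 / α) ^ 2 - q ^ 2 / 4) / 2) * α) + (q / 2 - 1 / α + δ)
        < -(σ - ν) ∧
      -(α * q - 2) ^ 2 / (8 * α) - ε < ((σ ^ 2 - ν ^ 2) / 2 - δ) / S - (σ - ν) := by
  have hβ : 0 < 1 / α := by positivity
  have h1 : ContinuousAt (fun t : ℝ => ((1 / α + t) ^ 2 - (q / 2) ^ 2) / 2 / (1 / α + 2 * t)
      - (1 / α + t - q / 2)) 0 := by
    refine ContinuousAt.sub (ContinuousAt.div (by fun_prop) (by fun_prop) ?_) (by fun_prop)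
    simpa using hα.ne'
  have h1' := h1.eventually (lt_mem_nhds (a := -(α * q - 2) ^ 2 / (8 * α) - ε) (by
    have : ((1 / α + 0) ^ 2 - (q / 2) ^ 2) / 2 / (1 / α + 2 * 0) - (1 / α + 0 - q / 2)
        = -(α * q - 2) ^ 2 / (8 * α) := by field_simp; ring
    beta_reduce; rw [this]; linarith))
  obtain ⟨t, ht, ht0 : 0 < t⟩ :=
    ((h1'.filter_mono nhdsWithin_le_nhds).and (self_mem_nhdsWithin (s := Set.Ioi 0))).exists
  set σ := 1 / α + t with hσ
  set S := 1 / α + 2 * t with hS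
  have hS0 : 0 < S := by positivity
  have e1 : ∀ᶠ δ : ℝ in nhds 0, (σ ^ 2 - (q / 2 - δ) ^ 2) / 2 < (S ^ 2 - q ^ 2 / 4) / 2 := by
    refine ContinuousAt.eventually_lt (by fun_prop) (by fun_prop) ?_
    nlinarith
  have e2 : ∀ᶠ δ : ℝ in nhds 0,
      ((1 / α) ^ 2 - q ^ 2 / 4) / 2 < (σ ^ 2 - (q / 2 - δ) ^ 2) / 2 - δ := by
    refine ContinuousAt.eventually_lt (by fun_prop) (by fun_prop) ?_
    nlinarith
  have e3 : ∀ᶠ δ : ℝ in nhds 0,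
      ((S ^ 2 - q ^ 2 / 4) / 2 - (σ ^ 2 - (q / 2 - δ) ^ 2) / 2 + δ) / S + (q / 2 - S + δ)
        < -(σ - (q / 2 - δ)) := by
    refine ContinuousAt.eventually_lt (by fun_prop) (by fun_prop) ?_
    rw [← sub_pos]
    have : -(σ - (q / 2 - 0)) - (((S ^ 2 - q ^ 2 / 4) / 2 - (σ ^ 2 - (q / 2 - 0) ^ 2) / 2 + 0) / S
        + (q / 2 - S + 0)) = (S - σ) ^ 2 / (2 * S) := by field_simp; ring
    rw [this]
    have : 0 < S - σ := by linarith
    positivity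
  have e4 : ∀ᶠ δ : ℝ in nhds 0,
      -(((σ ^ 2 - (q / 2 - δ) ^ 2) / 2 - δ - ((1 / α) ^ 2 - q ^ 2 / 4) / 2) * α)
        + (q / 2 - 1 / α + δ) < -(σ - (q / 2 - δ)) := by
    refine ContinuousAt.eventually_lt (by fun_prop) (by fun_prop) ?_
    rw [← sub_pos]
    have : -(σ - (q / 2 - 0)) - (-(((σ ^ 2 - (q / 2 - 0) ^ 2) / 2 - 0
        - ((1 / α) ^ 2 - q ^ 2 / 4) / 2) * α) + (q / 2 - 1 / α + 0)) = t ^ 2 * α / 2 := by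
      rw [hσ]; field_simp; ring
    rw [this]
    positivity
  have e5 : ∀ᶠ δ : ℝ in nhds 0, -(α * q - 2) ^ 2 / (8 * α) - ε
      < ((σ ^ 2 - (q / 2 - δ) ^ 2) / 2 - δ) / S - (σ - (q / 2 - δ)) := by
    refine ContinuousAt.eventually_lt (by fun_prop) (by fun_prop) ?_
    simpa using ht
  have e6 : ∀ᶠ δ : ℝ in nhds 0, δ < q / 2 := gt_mem_nhds (by positivity)
  obtain ⟨δ, ⟨h1, h2, h3, h4, h5, h6⟩, hδ : 0 < δ⟩ :=
    (((e1.and (e2.and (e3.and (e4.and (e5.and e6))))).filter_mono nhdsWithin_le_nhds).and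
      (self_mem_nhdsWithin (s := Set.Ioi 0))).exists
  exact ⟨S, σ, q / 2 - δ, δ, by linarith, by linarith, hδ, by linarith, by linarith, h1.le, h2.le,
    h3, h4, h5⟩

end Parameters

section Bounds

variable {c p α ε : ℝ}

theorem eventually_forall_mem_PsetPoly_le (hc : 0 < c) (hp : 0 < p) (hα : 0 < α)
    (hα' : α < 2 / (p + 2)) (hε : 0 < ε) :
    ∀ᶠ n : ℕ in atTop, ∀ t ∈ PsetPoly c p α n, t ≤ ENNReal.ofReal
      (Real.exp ((-(α * (p + 2) - 2) ^ 2 / (8 * α) + ε) * Real.log n)) := by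
  have hαp : (p + 2) / 2 < 1 / α := by
    rw [lt_div_iff₀ (by positivity)] at hα' ⊢
    linarith
  have hm : 0 ≤ ((1 / α) ^ 2 - (p + 2) ^ 2 / 4) / 2 := by nlinarith
  filter_upwards [eventually_laplace_le (V := ℕ) hc hp hαp hε,
    tendsto_log_natCast.eventually_gt_atTop 0, eventually_ge_atTop 1] with n h1 h2 hn
  rintro t ⟨G, o, z, μ, hμ, hd, hW, rfl⟩
  have hn0 : (0 : ℝ) < n := by positivity
  have h3 := G.hitBefore_le z (τ := α * n ^ 2 / Real.log n)
    (mul_nonneg hm (sq_nonneg (Real.log n / n))) o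
  rw [hμ.measure_hitTime_lt z]
  refine h3.trans ((mul_le_mul_right (h1 G o z hd hW) _).trans (le_of_eq ?_))
  rw [← ENNReal.ofReal_mul (Real.exp_nonneg _), ← Real.exp_add]
  congr 2
  field_simp
  ring

theorem eventually_exists_mem_PsetPoly_ge (hc : 0 < c) (hp : 0 < p) (hα : 0 < α)
    (hα' : α < 2 / (p + 2)) (hε : 0 < ε) :
    ∀ᶠ n : ℕ in atTop, ∃ t ∈ PsetPoly c p α n, ENNReal.ofReal
      (Real.exp ((-(α * (p + 2) - 2) ^ 2 / (8 * α) - ε) * Real.log n)) ≤ t := by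
  have hαp : (p + 2) / 2 < 1 / α := by
    rw [lt_div_iff₀ (by positivity)] at hα' ⊢
    linarith
  obtain ⟨S, σ, ν, δ, hν, hνq, hδ, hσ, hS, hA1, hA2, ha1, ha2, hv⟩ :=
    exists_parameters (by linarith : 0 < p + 2) hα hαp hε
  have hS0 : 0 < S := by linarith
  set A := (σ ^ 2 - ν ^ 2) / 2 with hA
  have hx : ∀ᶠ n : ℕ in atTop, σ ^ 4 / 4 * (Real.log n / n) ^ 2 < δ := by
    have h := (tendsto_log_div_natCast.pow 2).const_mul (σ ^ 4 / 4)
    rw [zero_pow two_ne_zero, mul_zero] at h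
    exact h.eventually (gt_mem_nhds hδ)
  filter_upwards [hx, eventually_laplace_le (V := ℕ) hc hp (by linarith : (p + 2) / 2 < S) hδ,
    eventually_laplace_le (V := ℕ) hc hp hαp hδ,
    eventually_exists_weightedGraph (p := p) hc hν (by linarith : ν < σ) (by linarith),
    eventually_le_exp_mul_log (by norm_num : (0 : ℝ) < 1 / 8) ha1,
    eventually_le_exp_mul_log (by norm_num : (0 : ℝ) < 1 / 8) ha2,
    eventually_le_exp_mul_log (by norm_num : (0 : ℝ) < 1 / 4) hv,
    tendsto_log_natCast.eventually_gt_atTop 0, eventually_ge_atTop 1]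
    with n hxn hL1 hL2 hG hE1 hE2 hE3 hl hn
  have hn0 : (0 : ℝ) < n := by positivity
  obtain ⟨G, hd, hW, hF⟩ := hG
  obtain ⟨μ, hμ⟩ := G.exists_isRandomWalk 0
  refine ⟨_, ⟨G, 0, {n}, μ, hμ, hd, hW, rfl⟩, ?_⟩
  have hP1 := hμ.1.measure_univ ▸ measure_mono (μ := μ)
    (Set.subset_univ {ω | hitTime {n} ω < ENNReal.ofReal (α * n ^ 2 / Real.log n)})
  rw [hμ.measure_hitTime_lt] at hP1 ⊢
  change G.hitBefore _ _ _ ≤ 1 at hP1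
  change _ ≤ G.hitBefore _ _ _
  set x := Real.log n / n with hx
  have hx0 : 0 < x := by positivity
  set lam := Real.log (Real.cosh (σ * x) / Real.cosh (ν * x))
  obtain ⟨hlam1, hlam2⟩ := log_cosh_div_cosh_bounds hν.le (by linarith : ν ≤ σ) hx0.le
  replace hlam1 : (A - δ) * x ^ 2 ≤ lam := by
    refine le_trans ?_ hlam1
    nlinarith [mul_le_mul_of_nonneg_right hxn.le (sq_nonneg x)]
  have hm : 0 ≤ ((1 / α) ^ 2 - (p + 2) ^ 2 / 4) / 2 := by nlinarith
  have h1 := mul_le_mul_of_nonneg_right hA1 (sq_nonneg x)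
  have h2 := mul_le_mul_of_nonneg_right hA2 (sq_nonneg x)
  have h3 := mul_nonneg hm (sq_nonneg x)
  have hsplit := hF.trans (G.laplace_le_add {n} (lam := lam) (τ₁ := n ^ 2 / (S * Real.log n))
    (τ₂ := α * n ^ 2 / Real.log n) (by linarith) (hlam2.trans h1) (h2.trans hlam1) 0)
  have hτ₁ : x ^ 2 * (n ^ 2 / (S * Real.log n)) = Real.log n / S := by rw [hx]; field_simp
  have hτ₂ : x ^ 2 * (α * n ^ 2 / Real.log n) = Real.log n * α := by rw [hx]; field_simp
  generalize hτ₁' : n ^ 2 / (S * Real.log n) = τ₁ at *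
  generalize hτ₂' : α * n ^ 2 / Real.log n = τ₂ at *
  have hτ₁0 : 0 ≤ τ₁ := by rw [← hτ₁']; positivity
  have hτ₂0 : 0 ≤ τ₂ := by rw [← hτ₂']; positivity
  set e := Real.exp (-(σ - ν) * Real.log n) with he
  have hT1 := mul_le_mul_right (hL1 G 0 {n} hd hW)
    (ENNReal.ofReal (Real.exp (((S ^ 2 - (p + 2) ^ 2 / 4) / 2 * x ^ 2 - lam) * τ₁)))
  have hT2 := mul_le_mul_right (hL2 G 0 {n} hd hW)
    (ENNReal.ofReal (Real.exp (-((lam - ((1 / α) ^ 2 - (p + 2) ^ 2 / 4) / 2 * x ^ 2) * τ₂))))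
  rw [← ENNReal.ofReal_mul (Real.exp_nonneg _), ← Real.exp_add] at hT1 hT2
  replace hT1 := hT1.trans (ENNReal.ofReal_le_ofReal (q := 1 / 8 * e) (by
    refine le_trans ?_ hE1
    rw [Real.exp_le_exp]
    have h4 := mul_le_mul_of_nonneg_right hlam1 hτ₁0
    have h5 : ((S ^ 2 - (p + 2) ^ 2 / 4) / 2 - A + δ) / S * Real.log n
        = ((S ^ 2 - (p + 2) ^ 2 / 4) / 2 - A + δ) * (x ^ 2 * τ₁) := by rw [hτ₁]; ring
    linear_combination h4 - h5))
  replace hT2 := hT2.trans (ENNReal.ofReal_le_ofReal (q := 1 / 8 * e) (by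
    refine le_trans ?_ hE2
    rw [Real.exp_le_exp]
    have h4 := mul_le_mul_of_nonneg_right hlam1 hτ₂0
    have h5 : -((A - δ - ((1 / α) ^ 2 - (p + 2) ^ 2 / 4) / 2) * α) * Real.log n
        = -((A - δ - ((1 / α) ^ 2 - (p + 2) ^ 2 / 4) / 2) * (x ^ 2 * τ₂)) := by rw [hτ₂]; ring
    linear_combination h4 - h5))
  replace hsplit := hsplit.trans (add_le_add (add_le_add_left hT1 _) hT2)
  rw [← ENNReal.ofReal_toReal (ne_top_of_le_ne_top ENNReal.one_ne_top hP1)] at hsplit ⊢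
  set P := (G.hitBefore {n} τ₂ 0).toReal
  have hP0 : 0 ≤ P := ENNReal.toReal_nonneg
  rw [← ENNReal.ofReal_mul (by positivity), ← ENNReal.ofReal_add (by positivity) (by positivity),
    ← ENNReal.ofReal_add (by positivity) (by positivity),
    ENNReal.ofReal_le_ofReal_iff (by positivity)] at hsplit
  refine ENNReal.ofReal_le_ofReal (hE3.trans ?_)
  calc 1 / 4 * Real.exp (((A - δ) / S - (σ - ν)) * Real.log n)
      = 1 / 4 * (Real.exp ((A - δ) * x ^ 2 * τ₁) * e) := by
        rw [he, ← Real.exp_add, mul_assoc (A - δ), hτ₁]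
        ring_nf
    _ ≤ 1 / 4 * (Real.exp (lam * τ₁) * e) := by gcongr
    _ = Real.exp (lam * τ₁) * (1 / 4 * e) := by ring
    _ ≤ Real.exp (lam * τ₁) * (Real.exp (-(lam * τ₁)) * P) :=
        mul_le_mul_of_nonneg_left (by linarith) (Real.exp_nonneg _)
    _ = P := by rw [← mul_assoc, ← Real.exp_add, add_neg_cancel, Real.exp_zero, one_mul]

end Bounds

/-- In the polynomial scaling,
`sup_G P[T_{oz} < α n²/log n] = n^{-(α(p+2)-2)²/(8α) + o(1)}`, the supremum being over
weighted graphs with `dist(o,z) ≥ n` and `w_z/w_o < c n^p`. -/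
theorem sup_hitting_probability_asymptotics
    (c p α : ℝ) (hc : 0 < c) (hp : 0 < p) (hα : 0 < α) (hα' : α < 2 / (p + 2)) :
    Tendsto
      (fun n : ℕ => Real.log (sSup (PsetPoly c p α n)).toReal / Real.log n)
      atTop (nhds (-(α * (p + 2) - 2) ^ 2 / (8 * α))) := by
  rw [Metric.tendsto_nhds]
  intro ε hε
  filter_upwards [eventually_forall_mem_PsetPoly_le hc hp hα hα' (half_pos hε),
    eventually_exists_mem_PsetPoly_ge hc hp hα hα' (half_pos hε),
    tendsto_log_natCast.eventually_gt_atTop 0] with n h1 h2 hl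
  obtain ⟨t, ht, htn⟩ := h2
  have hup := sSup_le h1
  have hlow := htn.trans (le_sSup ht)
  have htop := ne_top_of_le_ne_top ENNReal.ofReal_ne_top hup
  rw [← ENNReal.ofReal_toReal htop] at hup hlow
  rw [ENNReal.ofReal_le_ofReal_iff (Real.exp_nonneg _)] at hup
  rw [ENNReal.ofReal_le_ofReal_iff ENNReal.toReal_nonneg] at hlow
  have hpos := (Real.exp_pos _).trans_le hlow
  rw [← Real.le_log_iff_exp_le hpos, ← le_div_iff₀ hl] at hlow
  rw [← Real.log_le_iff_le_exp hpos, ← div_le_iff₀ hl] at hup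
  rw [Real.dist_eq, abs_lt]
  constructor <;> linarith

end RWHitting
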